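/- arXiv:2601.07679 — 4 statements merged into one kernel-verified Lean document; each statement's English description precedes it below -/
import Mathlib

section
/- Let n, a, b, t be positive integers with a ≥ b + t - 1, b ≥ 2 and n ≥ max{a+b, bt}. Suppose F ⊆ C([n],a) and G ⊆ C([n],b) are cross-intersecting families with F nonempty (τ(F) ≥ 1) and τ(G) ≥ t. Then |F| + |G| ≤ C(n,a) + Σ_{i=1}^{t} (-1)^i · C(t,i) · C(n-ib, a) + t. -/
open Finset

/-- Families `F` and `G` are cross-intersecting: every member of `F` meets every member of `G`. -/
def crossInt (F G : Finset (Finset ℕ)) : Prop :=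
  ∀ A ∈ F, ∀ B ∈ G, (A ∩ B).Nonempty

/-- The covering number of `F` (as a family of subsets of `[n] = Icc 1 n`) is at least `s`:
every `T ⊆ [n]` meeting all members of `F` has at least `s` elements. -/
def coverGE (n s : ℕ) (F : Finset (Finset ℕ)) : Prop :=
  ∀ T : Finset ℕ, T ⊆ Finset.Icc 1 n → (∀ A ∈ F, (T ∩ A).Nonempty) → s ≤ T.card

/-- The covering number of `F` equals `s`. -/
def coverEQ (n s : ℕ) (F : Finset (Finset ℕ)) : Prop :=
  coverGE n s F ∧
    ∃ T : Finset ℕ, T ⊆ Finset.Icc 1 n ∧ (∀ A ∈ F, (T ∩ A).Nonempty) ∧ T.card = s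

/-- `F` is initial (left-shifted): replacing an element `j` of a member by a smaller `i ∈ [n]`
not in it stays in the family. -/
def initialFam (n : ℕ) (F : Finset (Finset ℕ)) : Prop :=
  ∀ A ∈ F, ∀ i ∈ Finset.Icc 1 n, ∀ j ∈ A, i < j → i ∉ A → insert i (A.erase j) ∈ F

/-- `C(n,a) + ∑_{i=1}^t (-1)^i C(t,i) C(n-ib,a) + t`, the size of `M^t(n,a,b)`. -/
def MtSize (n a b t : ℕ) : ℤ :=
  (n.choose a : ℤ) +
    (∑ i ∈ Finset.Icc 1 t, (-1 : ℤ) ^ i * (t.choose i : ℤ) * ((n - i * b).choose a : ℤ)) + t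

/-- `C(n,a) - ∑_{i=0}^{t-1} C(b+t-1,i) C(n-b-t+1,a-i) + C(b+t-1,b)`, the size of `H^t(n,a,b)`. -/
def HtSize (n a b t : ℕ) : ℤ :=
  (n.choose a : ℤ) -
    (∑ i ∈ Finset.range t, ((b + t - 1).choose i : ℤ) * ((n - b - t + 1).choose (a - i) : ℤ)) +
    ((b + t - 1).choose b : ℤ)

/-- `∑_{i=1}^s (C(n-i,a-1) + ∑_{j=1}^{t-1} (-1)^j C(t-1,j) C(n-jb-i,a-1)) + C(n-s,b-s) + t - 1`,
the size of `M_s^t(n,a,b)`. -/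
def MstSize (n a b s t : ℕ) : ℤ :=
  (∑ i ∈ Finset.Icc 1 s, (((n - i).choose (a - 1) : ℤ) +
      ∑ j ∈ Finset.Icc 1 (t - 1),
        (-1 : ℤ) ^ j * ((t - 1).choose j : ℤ) * ((n - j * b - i).choose (a - 1) : ℤ))) +
    ((n - s).choose (b - s) : ℤ) + (t : ℤ) - 1

/-- `∑_{j=1}^s (C(n-j,a-1) - ∑_{i=0}^{t-j-1} C(b+t-j-1,i) C(n-b-t+1,a-i-1))
+ C(n-s,b-s) + C(b+t-1,b) - C(b+t-s-1,b-s)`, the size of `H_s^t(n,a,b)`. -/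
def HstSize (n a b s t : ℕ) : ℤ :=
  (∑ j ∈ Finset.Icc 1 s, (((n - j).choose (a - 1) : ℤ) -
      ∑ i ∈ Finset.range (t - j),
        ((b + t - j - 1).choose i : ℤ) * ((n - b - t + 1).choose (a - i - 1) : ℤ))) +
    ((n - s).choose (b - s) : ℤ) + ((b + t - 1).choose b : ℤ) -
    ((b + t - s - 1).choose (b - s) : ℤ)


/-! ### The counting function -/

def MM (b : ℕ) : ℕ → ℕ → ℕ → ℤ
  | 0, n, a => (n.choose a : ℤ)
  | k + 1, n, a => MM b k n a - MM b k (n - b) a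

lemma MM_succ (b k n a : ℕ) : MM b (k+1) n a = MM b k n a - MM b k (n - b) a := rfl

lemma MM_zero (b n a : ℕ) : MM b 0 n a = (n.choose a : ℤ) := rfl

lemma MM_pascal (b k : ℕ) : ∀ n a : ℕ, k * b ≤ n →
    MM b k (n+1) (a+1) = MM b k n (a+1) + MM b k n a := by
  induction k with
  | zero =>
    intro n a _
    simp only [MM_zero, Nat.choose_succ_succ]
    push_cast; ring
  | succ k ih =>
    intro n a h
    have h1 : k * b + b ≤ n := by rw [Nat.succ_mul] at h; exact h
    have e : n + 1 - b = (n - b) + 1 := by omega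
    simp only [MM_succ]
    rw [e, ih n a (by omega), ih (n - b) a (by omega)]
    ring

lemma MM_zero_step (b k : ℕ) : ∀ n : ℕ, MM b k (n+1) 0 = MM b k n 0 := by
  have key : ∀ k n m : ℕ, MM b k n 0 = MM b k m 0 := by
    intro k
    induction k with
    | zero => intro n m; simp [MM_zero]
    | succ k ih =>
      intro n m
      simp only [MM_succ]
      rw [ih n m, ih (n-b) (m-b)]
  intro n
  exact key k _ _

lemma MM_nonneg_mono (b k : ℕ) : (∀ n a : ℕ, k * b ≤ n → 0 ≤ MM b k n a) ∧
    (∀ n m a : ℕ, k * b ≤ n → n ≤ m → MM b k n a ≤ MM b k m a) := by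
  have step : ∀ k, (∀ n a : ℕ, k * b ≤ n → 0 ≤ MM b k n a) →
      (∀ n m a : ℕ, k * b ≤ n → n ≤ m → MM b k n a ≤ MM b k m a) := by
    intro k h n m a hn hm
    induction m, hm using Nat.le_induction with
    | base => exact le_rfl
    | succ m hm ih =>
      refine ih.trans ?_
      cases a with
      | zero => rw [MM_zero_step]
      | succ a =>
        rw [MM_pascal b k m a (by omega)]
        have := h m a (by omega)
        linarith
  have nn : ∀ k, ∀ n a : ℕ, k * b ≤ n → 0 ≤ MM b k n a := by
    intro k
    induction k with
    | zero => intro n a _; simp [MM_zero]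
    | succ k ih =>
      intro n a h
      have h1 : k * b + b ≤ n := by rw [Nat.succ_mul] at h; exact h
      rw [MM_succ]
      have := step k ih (n - b) n a (by omega) (by omega)
      linarith
  exact ⟨nn k, step k (nn k)⟩

lemma MM_nonneg (b k n a : ℕ) (h : k * b ≤ n) : 0 ≤ MM b k n a := (MM_nonneg_mono b k).1 n a h

lemma MM_mono (b k n m a : ℕ) (h : k * b ≤ n) (hm : n ≤ m) : MM b k n a ≤ MM b k m a :=
  (MM_nonneg_mono b k).2 n m a h hm

lemma MM_pos (b : ℕ) (hb : 1 ≤ b) (k : ℕ) : ∀ n a : ℕ, k * b ≤ n → k ≤ a → a ≤ n →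
    1 ≤ MM b k n a := by
  induction k with
  | zero =>
    intro n a _ _ h
    rw [MM_zero]
    exact_mod_cast Nat.choose_pos h
  | succ k ih =>
    intro n a h h2 h3
    have h1 : k * b + b ≤ n := by rw [Nat.succ_mul] at h; exact h
    obtain ⟨n, rfl⟩ : ∃ m, n = m + 1 := ⟨n - 1, by omega⟩
    obtain ⟨a, rfl⟩ : ∃ m, a = m + 1 := ⟨a - 1, by omega⟩
    rw [MM_succ, MM_pascal b k n a (by omega)]
    have := MM_mono b k (n + 1 - b) n (a+1) (by omega) (by omega)
    have := ih n a (by omega) (by omega) (by omega)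
    linarith

lemma MM_gap (b k n a c : ℕ) (hcb : c < b) (h : (k+1) * b ≤ n) (hk : k + 1 ≤ a)
    (hn : a + c ≤ n) : MM b k n a - MM b k (n - c) a + 1 ≤ MM b (k+1) n a := by
  have h1 : k * b + b ≤ n := by rw [Nat.succ_mul] at h; exact h
  rw [MM_succ]
  obtain ⟨a, rfl⟩ : ∃ m, a = m + 1 := ⟨a - 1, by omega⟩
  have e : n - c = (n - c - 1) + 1 := by omega
  rw [e, MM_pascal b k (n-c-1) a (by omega)]
  have := MM_mono b k (n - b) (n - c - 1) (a+1) (by omega) (by omega)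
  have := MM_pos b (by omega) k (n-c-1) a (by omega) (by omega) (by omega)
  linarith

lemma MM_closed (b k : ℕ) : ∀ n a : ℕ, MM b k n a =
    ∑ i ∈ Finset.range (k+1), (-1 : ℤ) ^ i * (k.choose i : ℤ) * ((n - i * b).choose a : ℤ) := by
  induction k with
  | zero => intro n a; simp [MM_zero]
  | succ k ih =>
    intro n a
    rw [MM_succ, ih, ih]
    have e : ∀ i, n - b - i * b = n - (i+1) * b := by
      intro i; rw [Nat.succ_mul]; omega
    simp only [e]
    rw [Finset.sum_range_succ' _ (k+1)]
    simp only [Nat.choose_succ_succ k]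
    have : ∑ i ∈ Finset.range (k+1), (-1 : ℤ) ^ i * (k.choose i : ℤ) * ((n - i * b).choose a : ℤ)
      = ∑ i ∈ Finset.range (k+1),
        (-1 : ℤ) ^ (i+1) * (k.choose (i+1) : ℤ) * ((n - (i+1) * b).choose a : ℤ)
        + (-1 : ℤ) ^ 0 * (k.choose 0 : ℤ) * ((n - 0 * b).choose a : ℤ) := by
      rw [← Finset.sum_range_succ'
        (fun i => (-1 : ℤ) ^ i * (k.choose i : ℤ) * ((n - i * b).choose a : ℤ)) (k+1),
        Finset.sum_range_succ _ (k+1)]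
      simp
    rw [this, add_sub_right_comm, ← Finset.sum_sub_distrib]
    congr 1
    · apply Finset.sum_congr rfl
      intro i _
      push_cast
      ring
    · simp

lemma MtSize_eq (n a b t : ℕ) : MtSize n a b t = MM b t n a + t := by
  rw [MM_closed, MtSize, Finset.range_eq_Ico, Finset.sum_eq_sum_Ico_succ_bot (by omega)]
  have : Finset.Ico (0+1) (t+1) = Finset.Icc 1 t := by rfl
  rw [this]
  simp

/-! ### Links, deletions, covers -/

def lnk (y : ℕ) (F : Finset (Finset ℕ)) : Finset (Finset ℕ) :=
  (F.filter (fun A => y ∈ A)).image (fun A => A.erase y)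

def del (y : ℕ) (F : Finset (Finset ℕ)) : Finset (Finset ℕ) := F.filter (fun A => y ∉ A)

def trc (y : ℕ) (F : Finset (Finset ℕ)) : Finset (Finset ℕ) := F.image (fun A => A.erase y)

def cov (k : ℕ) (G : Finset (Finset ℕ)) : Prop :=
  ∀ T : Finset ℕ, (∀ B ∈ G, (T ∩ B).Nonempty) → k ≤ T.card

lemma mem_lnk {y : ℕ} {F : Finset (Finset ℕ)} {A : Finset ℕ} :
    A ∈ lnk y F ↔ ∃ A' ∈ F, y ∈ A' ∧ A'.erase y = A := by
  simp [lnk, and_assoc]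

lemma mem_del {y : ℕ} {F : Finset (Finset ℕ)} {A : Finset ℕ} :
    A ∈ del y F ↔ A ∈ F ∧ y ∉ A := by
  simp [del]

lemma mem_trc {y : ℕ} {F : Finset (Finset ℕ)} {A : Finset ℕ} :
    A ∈ trc y F ↔ ∃ A' ∈ F, A'.erase y = A := by
  simp [trc]

lemma card_lnk_del (y : ℕ) (F : Finset (Finset ℕ)) :
    (lnk y F).card + (del y F).card = F.card := by
  unfold lnk del
  rw [Finset.card_image_of_injOn, Finset.card_filter_add_card_filter_not]
  intro A hA B hB h
  simp only [Finset.coe_filter, Set.mem_ofPred_eq] at hA hB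
  have h' : A.erase y = B.erase y := h
  rw [← Finset.insert_erase hA.2, ← Finset.insert_erase hB.2, h']

lemma lnk_sub {y a : ℕ} {F : Finset (Finset ℕ)} {S : Finset ℕ}
    (h : F ⊆ S.powersetCard a) : lnk y F ⊆ (S.erase y).powersetCard (a-1) := by
  intro A hA
  obtain ⟨A', hA', hy, rfl⟩ := mem_lnk.1 hA
  have := Finset.mem_powersetCard.1 (h hA')
  rw [Finset.mem_powersetCard]
  exact ⟨Finset.erase_subset_erase _ this.1, by rw [Finset.card_erase_of_mem hy, this.2]⟩

lemma del_sub {y a : ℕ} {F : Finset (Finset ℕ)} {S : Finset ℕ}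
    (h : F ⊆ S.powersetCard a) : del y F ⊆ (S.erase y).powersetCard a := by
  intro A hA
  obtain ⟨hA', hy⟩ := mem_del.1 hA
  have := Finset.mem_powersetCard.1 (h hA')
  rw [Finset.mem_powersetCard]
  refine ⟨fun z hz => Finset.mem_erase.2 ⟨?_, this.1 hz⟩, this.2⟩
  rintro rfl; exact hy hz

lemma lnk_sub_trc {y : ℕ} {F : Finset (Finset ℕ)} : lnk y F ⊆ trc y F := by
  intro A hA
  obtain ⟨A', hA', hy, rfl⟩ := mem_lnk.1 hA
  exact mem_trc.2 ⟨A', hA', rfl⟩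

lemma cross_lnk_del {y : ℕ} {F G : Finset (Finset ℕ)} (h : crossInt F G) :
    crossInt (lnk y F) (del y G) := by
  intro A hA B hB
  obtain ⟨A', hA', hy, rfl⟩ := mem_lnk.1 hA
  obtain ⟨hB', hy'⟩ := mem_del.1 hB
  obtain ⟨z, hz⟩ := h A' hA' B hB'
  rw [Finset.mem_inter] at hz
  refine ⟨z, Finset.mem_inter.2 ⟨Finset.mem_erase.2 ⟨?_, hz.1⟩, hz.2⟩⟩
  rintro rfl; exact hy' hz.2

lemma cross_del_trc {y : ℕ} {F G : Finset (Finset ℕ)} (h : crossInt F G) :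
    crossInt (del y F) (trc y G) := by
  intro A hA B hB
  obtain ⟨B', hB', rfl⟩ := mem_trc.1 hB
  obtain ⟨hA', hy'⟩ := mem_del.1 hA
  obtain ⟨z, hz⟩ := h A hA' B' hB'
  rw [Finset.mem_inter] at hz
  refine ⟨z, Finset.mem_inter.2 ⟨hz.1, Finset.mem_erase.2 ⟨?_, hz.2⟩⟩⟩
  rintro rfl; exact hy' hz.1

lemma cov_del {k y : ℕ} {G : Finset (Finset ℕ)} (h : cov (k+1) G) : cov k (del y G) := by
  intro T hT
  have := h (insert y T) (by
    intro B hB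
    by_cases hy : y ∈ B
    · exact ⟨y, by simp [hy]⟩
    · obtain ⟨z, hz⟩ := hT B (mem_del.2 ⟨hB, hy⟩)
      rw [Finset.mem_inter] at hz
      exact ⟨z, by simp [hz.1, hz.2]⟩)
  have := Finset.card_insert_le y T
  omega

lemma cov_trc {k y : ℕ} {G : Finset (Finset ℕ)} (h : cov k G) : cov k (trc y G) := by
  intro T hT
  apply h T
  intro B hB
  obtain ⟨z, hz⟩ := hT (B.erase y) (mem_trc.2 ⟨B, hB, rfl⟩)
  rw [Finset.mem_inter, Finset.mem_erase] at hz
  exact ⟨z, by simp [hz.1, hz.2.2]⟩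

lemma cov_nonempty {k : ℕ} {G : Finset (Finset ℕ)} (h : cov (k+1) G) : G.Nonempty := by
  by_contra hne
  rw [Finset.not_nonempty_iff_eq_empty] at hne
  have := h ∅ (by simp [hne])
  simp at this

lemma size_del {y b : ℕ} {G : Finset (Finset ℕ)} (h : ∀ B ∈ G, B.card ≤ b) :
    ∀ B ∈ del y G, B.card ≤ b := fun B hB => h B (mem_del.1 hB).1

lemma size_trc {y b : ℕ} {G : Finset (Finset ℕ)} (h : ∀ B ∈ G, B.card ≤ b) :
    ∀ B ∈ trc y G, B.card ≤ b := by
  intro B hB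
  obtain ⟨B', hB', rfl⟩ := mem_trc.1 hB
  exact (Finset.card_erase_le).trans (h B' hB')

/-! ### Bound on `F` alone -/

lemma F_empty_of_empty_mem {F G : Finset (Finset ℕ)} (h : crossInt F G) (h0 : ∅ ∈ G) :
    F = ∅ := by
  apply Finset.eq_empty_of_forall_notMem
  intro A hA
  have := h A hA ∅ h0
  simp at this

lemma boundQ_aux (b k : ℕ)
    (ih : ∀ (S : Finset ℕ) (a : ℕ) (F G : Finset (Finset ℕ)), k * b ≤ S.card →
      F ⊆ S.powersetCard a → crossInt F G → (∀ B ∈ G, B.card ≤ b) → cov k G →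
      (F.card : ℤ) ≤ MM b k S.card a) (c : ℕ) :
    ∀ (S : Finset ℕ) (a : ℕ) (F G : Finset (Finset ℕ)) (B1 : Finset ℕ), c + k * b ≤ S.card →
      F ⊆ S.powersetCard a → crossInt F G → (∀ B ∈ G, B.card ≤ b) → cov (k+1) G →
      B1 ∈ G → B1 ⊆ S → B1.card = c →
      (F.card : ℤ) ≤ MM b k S.card a - MM b k (S.card - c) a := by
  induction c with
  | zero =>
    intro S a F G B1 hn hF hX hs hc hB1 hB1S hB1c
    rw [Finset.card_eq_zero] at hB1c
    subst hB1c
    rw [F_empty_of_empty_mem hX hB1]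
    simp
  | succ c ihc =>
    intro S a F G B1 hn hF hX hs hc hB1 hB1S hB1c
    obtain ⟨y, hy⟩ : B1.Nonempty := by rw [← Finset.card_pos]; omega
    have hyS := hB1S hy
    have hcard := Finset.card_erase_of_mem hyS
    cases a with
    | zero =>
      have hFe : F = ∅ := by
        apply Finset.eq_empty_of_forall_notMem
        intro A hA
        have h1 := Finset.mem_powersetCard.1 (hF hA)
        rw [Finset.card_eq_zero] at h1
        have := hX A hA B1 hB1
        simp [h1.2] at this
      rw [hFe]
      have := MM_mono b k (S.card - (c+1)) S.card 0 (by omega) (by omega)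
      simp; linarith
    | succ a =>
      have h1 := ih (S.erase y) a (lnk y F) (del y G) (by omega) (lnk_sub hF)
        (cross_lnk_del hX) (size_del hs) (cov_del hc)
      have h2 := ihc (S.erase y) (a+1) (del y F) (trc y G) (B1.erase y) (by omega) (del_sub hF)
        (cross_del_trc hX) (size_trc hs) (cov_trc hc) (mem_trc.2 ⟨B1, hB1, rfl⟩)
        (Finset.erase_subset_erase _ hB1S) (by rw [Finset.card_erase_of_mem hy]; omega)
      have h3 := card_lnk_del y F
      rw [hcard] at h1 h2
      obtain ⟨N, hN⟩ : ∃ N, S.card = N + 1 := ⟨S.card - 1, by omega⟩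
      rw [hN] at h1 h2 ⊢
      have e1 : N + 1 - 1 = N := rfl
      have e2 : N + 1 - (c+1) = N - c := by omega
      rw [e1] at h1 h2
      rw [e2, MM_pascal b k N a (by omega), ← h3]
      push_cast
      linarith

lemma boundQ (b k : ℕ) : ∀ (S : Finset ℕ) (a : ℕ) (F G : Finset (Finset ℕ)), k * b ≤ S.card →
      F ⊆ S.powersetCard a → crossInt F G → (∀ B ∈ G, B.card ≤ b) → cov k G →
      (F.card : ℤ) ≤ MM b k S.card a := by
  induction k with
  | zero =>
    intro S a F G _ hF _ _ _
    rw [MM_zero]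
    have := Finset.card_le_card hF
    rw [Finset.card_powersetCard] at this
    exact_mod_cast this
  | succ k ih =>
    intro S a F G hn hF hX hs hc
    have h1 : k * b + b ≤ S.card := by rw [Nat.succ_mul] at hn; exact hn
    -- restrict `G` to `S`
    let G' := G.image (fun B => B ∩ S)
    have hX' : crossInt F G' := by
      intro A hA B hB
      obtain ⟨B', hB', rfl⟩ := Finset.mem_image.1 hB
      obtain ⟨z, hz⟩ := hX A hA B' hB'
      rw [Finset.mem_inter] at hz
      have := (Finset.mem_powersetCard.1 (hF hA)).1 hz.1
      exact ⟨z, by simp [hz.1, hz.2, this]⟩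
    have hs' : ∀ B ∈ G', B.card ≤ b := by
      intro B hB
      obtain ⟨B', hB', rfl⟩ := Finset.mem_image.1 hB
      exact (Finset.card_le_card Finset.inter_subset_left).trans (hs B' hB')
    have hc' : cov (k+1) G' := by
      intro T hT
      apply hc
      intro B hB
      obtain ⟨z, hz⟩ := hT (B ∩ S) (Finset.mem_image.2 ⟨B, hB, rfl⟩)
      simp only [Finset.mem_inter] at hz
      exact ⟨z, by simp [hz.1, hz.2.1]⟩
    obtain ⟨B1, hB1⟩ := cov_nonempty hc'
    have hB1S : B1 ⊆ S := by
      obtain ⟨B', hB', rfl⟩ := Finset.mem_image.1 hB1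
      exact Finset.inter_subset_right
    have hB1b := hs' B1 hB1
    have := boundQ_aux b k ih B1.card S a F G' B1 (by omega) hF hX' hs' hc' hB1 hB1S rfl
    have := MM_mono b k (S.card - b) (S.card - B1.card) a (by omega) (by omega)
    rw [MM_succ]
    linarith

/-! ### Base case by double counting -/

lemma card_meeting (S B0 : Finset ℕ) (a : ℕ) (h : B0 ⊆ S) :
    ((S.powersetCard a).filter (fun A => (A ∩ B0).Nonempty)).card
      + (S.card - B0.card).choose a = S.card.choose a := by
  rw [← Finset.card_powersetCard a S,
    ← Finset.card_filter_add_card_filter_not (s := S.powersetCard a)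
      (fun A => (A ∩ B0).Nonempty)]
  congr 1
  rw [← Finset.card_sdiff_of_subset h, ← Finset.card_powersetCard]
  congr 1
  ext A
  simp only [Finset.mem_powersetCard, Finset.mem_filter, Finset.not_nonempty_iff_eq_empty,
    ← Finset.disjoint_iff_inter_eq_empty, Finset.subset_sdiff]
  tauto

lemma base_lt (S : Finset ℕ) (a c : ℕ) (F G : Finset (Finset ℕ)) (hca : c < a)
    (hn : a + c ≤ S.card) (hF : F ⊆ S.powersetCard a) (hG : G ⊆ S.powersetCard c)
    (hX : crossInt F G) (hne : G.Nonempty) :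
    (F.card : ℤ) + G.card ≤ (S.card.choose a : ℤ) - ((S.card - c).choose a : ℤ) + 1 := by
  obtain ⟨B0, hB0⟩ := hne
  have hB0' := Finset.mem_powersetCard.1 (hG hB0)
  let M := (S.powersetCard a).filter (fun A => (A ∩ B0).Nonempty)
  have hM := card_meeting S B0 a hB0'.1
  have hFM : F ⊆ M := fun A hA => Finset.mem_filter.2 ⟨hF hA, hX A hA B0 hB0⟩
  have hXY : (G.erase B0).card ≤ (M \ F).card := by
    have key := Finset.card_mul_le_card_mul (s := G.erase B0) (t := M \ F)
      (fun B A => Disjoint B A)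
      (m := (S.card - c - 1).choose (a-1)) (n := (S.card - a).choose c) ?_ ?_
    · have h1 : (S.card - a).choose c ≤ (S.card - c - 1).choose (a-1) := by
        have e1 : (S.card - a).choose c = (S.card - a).choose (S.card - a - c) :=
          (Nat.choose_symm (by omega)).symm
        have e2 : (S.card - c - 1).choose (a-1) =
            (S.card - c - 1).choose (S.card - c - 1 - (a-1)) :=
          (Nat.choose_symm (by omega)).symm
        have e3 : S.card - c - 1 - (a-1) = S.card - a - c := by omega
        rw [e1, e2, e3]
        exact Nat.choose_le_choose _ (by omega)
      have h2 : 0 < (S.card - c - 1).choose (a-1) := Nat.choose_pos (by omega)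
      exact Nat.le_of_mul_le_mul_right (key.trans (Nat.mul_le_mul_left _ h1)) h2
    · intro B hB
      obtain ⟨hBne, hBG⟩ := Finset.mem_erase.1 hB
      have hB' := Finset.mem_powersetCard.1 (hG hBG)
      obtain ⟨y, hy, hyB⟩ : ∃ y ∈ B0, y ∉ B := by
        by_contra hcon
        push Not at hcon
        exact hBne (Finset.eq_of_subset_of_card_le hcon (by omega)).symm
      have hyS := hB0'.1 hy
      have hc1 : ((S \ B).erase y).card = S.card - c - 1 := by
        rw [Finset.card_erase_of_mem (by simp [hyS, hyB]), Finset.card_sdiff_of_subset hB'.1,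
          hB'.2]
      rw [← hc1, ← Finset.card_powersetCard]
      apply Finset.card_le_card_of_injOn (fun A => insert y A)
      · intro A hA
        have hA' := Finset.mem_powersetCard.1 hA
        have hyA : y ∉ A := fun h => by simpa using hA'.1 h
        have hd : Disjoint B (insert y A) := by
          rw [Finset.disjoint_left]
          intro z hz hz'
          rcases Finset.mem_insert.1 hz' with rfl | h
          · exact hyB hz
          · have := hA'.1 h
            simp [hz] at this
        simp only [Finset.coe_bipartiteAbove, Set.mem_ofPred_eq, Finset.mem_sdiff, M,
          Finset.mem_filter, Finset.mem_powersetCard]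
        refine ⟨⟨⟨⟨?_, ?_⟩, ⟨y, by simp [hy]⟩⟩, ?_⟩, hd⟩
        · intro z hz
          rcases Finset.mem_insert.1 hz with rfl | h
          · exact hyS
          · have := hA'.1 h
            simp at this
            exact this.2.1
        · rw [Finset.card_insert_of_notMem hyA, hA'.2]; omega
        · intro hAF
          have := hX _ hAF B hBG
          rw [Finset.disjoint_iff_inter_eq_empty, Finset.inter_comm] at hd
          rw [hd] at this
          simp at this
      · intro A hA A2 hA2 h
        have hyA : y ∉ A := fun h => by
          simpa using (Finset.mem_powersetCard.1 hA).1 h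
        have hyA2 : y ∉ A2 := fun h => by
          simpa using (Finset.mem_powersetCard.1 hA2).1 h
        have h' : insert y A = insert y A2 := h
        rw [← Finset.erase_insert hyA, ← Finset.erase_insert hyA2, h']
    · intro A hA
      have hA' := Finset.mem_powersetCard.1 (Finset.mem_filter.1 (Finset.mem_sdiff.1 hA).1).1
      rw [← hA'.2, ← Finset.card_sdiff_of_subset hA'.1, ← Finset.card_powersetCard]
      apply Finset.card_le_card
      intro B hB
      simp only [Finset.mem_bipartiteBelow] at hB
      have hB' := Finset.mem_powersetCard.1 (hG (Finset.mem_erase.1 hB.1).2)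
      rw [Finset.mem_powersetCard]
      exact ⟨Finset.subset_sdiff.2 ⟨hB'.1, hB.2⟩, hB'.2⟩
  have h1 := Finset.card_erase_add_one hB0
  have h2 := Finset.card_sdiff_add_card_eq_card hFM
  rw [hB0'.2] at hM
  have h3 : M.card + (S.card - c).choose a = S.card.choose a := hM
  have : F.card + G.card + (S.card - c).choose a ≤ S.card.choose a + 1 := by omega
  have h4 : (F.card : ℤ) + G.card + ((S.card - c).choose a : ℤ) ≤ (S.card.choose a : ℤ) + 1 := by
    exact_mod_cast this
  linarith

/-! ### The auxiliary strict bound -/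

lemma boundP (b k : ℕ) : ∀ (c : ℕ) (S : Finset ℕ) (a : ℕ) (F G G1 : Finset (Finset ℕ)),
    c < b → c + k + 1 ≤ a → a + c ≤ S.card → c + k * b ≤ S.card →
    F ⊆ S.powersetCard a → G1 ⊆ S.powersetCard c → G1 ⊆ G → G1.Nonempty →
    crossInt F G → (∀ B ∈ G, B.card ≤ b) → cov (k+1) G →
    (F.card : ℤ) + G1.card ≤ MM b k S.card a - MM b k (S.card - c) a + 1 := by
  induction k with
  | zero =>
    intro c S a F G G1 hcb hca hn1 hn2 hF hG1 hGG hne hX hs hc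
    rw [MM_zero, MM_zero]
    exact base_lt S a c F G1 (by omega) hn1 hF hG1 (fun A hA B hB => hX A hA B (hGG hB)) hne
  | succ k ihk =>
    intro c
    induction c with
    | zero =>
      intro S a F G G1 hcb hca hn1 hn2 hF hG1 hGG hne hX hs hc
      have h1 := Finset.card_le_card hG1
      simp at h1
      obtain ⟨B0, hB0⟩ := hne
      have h2 := (Finset.mem_powersetCard.1 (hG1 hB0)).2
      rw [Finset.card_eq_zero] at h2
      subst h2
      rw [F_empty_of_empty_mem hX (hGG hB0)]
      simp
      have := Finset.card_le_card hG1
      simpa using this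
    | succ c ihc =>
      intro S a F G G1 hcb hca hn1 hn2 hF hG1 hGG hne hX hs hc
      have hkb : (k+1) * b = k * b + b := Nat.succ_mul k b
      obtain ⟨B0, hB0⟩ := hne
      have hB0' := Finset.mem_powersetCard.1 (hG1 hB0)
      obtain ⟨y, hy⟩ : B0.Nonempty := by rw [← Finset.card_pos]; omega
      have hyS := hB0'.1 hy
      have hcard := Finset.card_erase_of_mem hyS
      obtain ⟨a, rfl⟩ : ∃ a', a = a' + 1 := ⟨a - 1, by omega⟩
      have h1 : ((lnk y F).card : ℤ) + (del y G1).card ≤ MM b (k+1) (S.card - 1) a := by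
        by_cases hd : (del y G1).Nonempty
        · have := ihk (c+1) (S.erase y) a (lnk y F) (del y G) (del y G1) hcb (by omega)
            (by omega) (by omega) (lnk_sub hF) (del_sub hG1)
            (by intro B hB; rw [mem_del] at hB ⊢; exact ⟨hGG hB.1, hB.2⟩) hd
            (cross_lnk_del hX) (size_del hs) (cov_del hc)
          rw [hcard] at this
          exact this.trans (MM_gap b k (S.card - 1) a (c+1) hcb (by omega) (by omega) (by omega))
        · rw [Finset.not_nonempty_iff_eq_empty] at hd
          rw [hd]
          have := boundQ b (k+1) (S.erase y) a (lnk y F) (del y G) (by omega)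
            (lnk_sub hF) (cross_lnk_del hX) (size_del hs) (cov_del hc)
          rw [hcard] at this
          simpa using this
      have h2 := ihc (S.erase y) (a+1) (del y F) (trc y G) (lnk y G1) (by omega) (by omega)
        (by omega) (by omega) (del_sub hF) (lnk_sub hG1)
        (lnk_sub_trc.trans (Finset.image_subset_image hGG))
        ⟨B0.erase y, mem_lnk.2 ⟨B0, hB0, hy, rfl⟩⟩ (cross_del_trc hX) (size_trc hs) (cov_trc hc)
      have h3 := card_lnk_del y F
      have h4 := card_lnk_del y G1
      rw [hcard] at h2
      obtain ⟨N, hN⟩ : ∃ N, S.card = N + 1 := ⟨S.card - 1, by omega⟩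
      rw [hN] at h1 h2 ⊢
      have e1 : N + 1 - 1 = N := rfl
      have e2 : N + 1 - (c+1) = N - c := by omega
      rw [e1] at h1 h2
      rw [e2, MM_pascal b (k+1) N a (by omega), ← h3, ← h4]
      push_cast
      linarith

/-! ### The case `t = 1`, `a = b` -/

def sw (x y : ℕ) (B : Finset ℕ) : Finset ℕ := B.image (Equiv.swap x y)

lemma mem_sw {x y z : ℕ} {B : Finset ℕ} : z ∈ sw x y B ↔ Equiv.swap x y z ∈ B := by
  unfold sw
  rw [Finset.mem_image]
  constructor
  · rintro ⟨w, hw, rfl⟩; simpa using hw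
  · intro h; exact ⟨_, h, by simp⟩

lemma sw_inj (x y : ℕ) : Function.Injective (sw x y) :=
  Finset.image_injective (Equiv.swap x y).injective

lemma sw_card (x y : ℕ) (B : Finset ℕ) : (sw x y B).card = B.card :=
  Finset.card_image_of_injective _ (Equiv.swap x y).injective

lemma sw_fix {x y : ℕ} {B : Finset ℕ} (h : x ∈ B ↔ y ∈ B) : sw x y B = B := by
  ext z
  rw [mem_sw, Equiv.swap_apply_def]
  split_ifs with h1 h2
  · subst h1; exact h.symm
  · subst h2; exact h
  · rfl

lemma sw_mem_powersetCard {x y b : ℕ} {B S : Finset ℕ} (hx : x ∈ S) (hy : y ∈ S)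
    (h : B ∈ S.powersetCard b) : sw x y B ∈ S.powersetCard b := by
  rw [Finset.mem_powersetCard] at h ⊢
  refine ⟨?_, by rw [sw_card, h.2]⟩
  intro z hz
  rw [mem_sw, Equiv.swap_apply_def] at hz
  split_ifs at hz with h1 h2
  · subst h1; exact hx
  · subst h2; exact hy
  · exact h.1 hz

def swf (x y : ℕ) (G : Finset (Finset ℕ)) : Finset (Finset ℕ) := G.image (sw x y)

lemma swf_card (x y : ℕ) (G : Finset (Finset ℕ)) : (swf x y G).card = G.card :=
  Finset.card_image_of_injective _ (sw_inj x y)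

lemma swf_cross {x y : ℕ} {F G : Finset (Finset ℕ)} (h : crossInt F G) :
    crossInt (swf x y F) (swf x y G) := by
  intro A hA B hB
  obtain ⟨A', hA', rfl⟩ := Finset.mem_image.1 hA
  obtain ⟨B', hB', rfl⟩ := Finset.mem_image.1 hB
  obtain ⟨z, hz⟩ := h A' hA' B' hB'
  rw [Finset.mem_inter] at hz
  refine ⟨Equiv.swap x y z, ?_⟩
  rw [Finset.mem_inter, mem_sw, mem_sw]
  simpa using hz

lemma swf_sub {x y b : ℕ} {G : Finset (Finset ℕ)} {S : Finset ℕ} (hx : x ∈ S) (hy : y ∈ S)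
    (h : G ⊆ S.powersetCard b) : swf x y G ⊆ S.powersetCard b := by
  intro A hA
  obtain ⟨A', hA', rfl⟩ := Finset.mem_image.1 hA
  exact sw_mem_powersetCard hx hy (h hA')

def goodPair (S : Finset ℕ) (b : ℕ) (F G : Finset (Finset ℕ)) : Prop :=
  F ⊆ S.powersetCard b ∧ G ⊆ S.powersetCard b ∧ crossInt F G ∧ F.Nonempty ∧ G.Nonempty

lemma cross_symm {F G : Finset (Finset ℕ)} (h : crossInt F G) : crossInt G F := by
  intro A hA B hB
  rw [Finset.inter_comm]
  exact h B hB A hA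

/-- An extremal pair whose second family is as small as possible. -/
lemma exists_extremal (S : Finset ℕ) (b : ℕ) (F0 G0 : Finset (Finset ℕ))
    (h0 : goodPair S b F0 G0) : ∃ F G, goodPair S b F G ∧
      (∀ F' G', goodPair S b F' G' → F'.card + G'.card ≤ F.card + G.card) ∧
      (∀ F' G', goodPair S b F' G' → F'.card + G'.card = F.card + G.card →
        G.card ≤ G'.card) := by
  classical
  let U := ((S.powersetCard b).powerset ×ˢ (S.powersetCard b).powerset).filter
    (fun p => goodPair S b p.1 p.2)
  have memU : ∀ F G, goodPair S b F G → (F, G) ∈ U := by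
    intro F G h
    simp only [U, Finset.mem_filter, Finset.mem_product, Finset.mem_powerset]
    exact ⟨⟨h.1, h.2.1⟩, h⟩
  obtain ⟨p, hp, hmax⟩ := Finset.exists_max_image U (fun p => p.1.card + p.2.card)
    ⟨_, memU _ _ h0⟩
  let V := U.filter (fun q => q.1.card + q.2.card = p.1.card + p.2.card)
  obtain ⟨q, hq, hmin⟩ := Finset.exists_min_image V (fun q => q.2.card)
    ⟨p, Finset.mem_filter.2 ⟨hp, rfl⟩⟩
  obtain ⟨hqU, hqe⟩ := Finset.mem_filter.1 hq
  refine ⟨q.1, q.2, (Finset.mem_filter.1 hqU).2, ?_, ?_⟩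
  · intro F' G' h
    rw [hqe]
    exact hmax _ (memU _ _ h)
  · intro F' G' h he
    exact hmin (F', G') (Finset.mem_filter.2 ⟨memU _ _ h, by rw [← hqe, ← he]⟩)

lemma block_prop (S : Finset ℕ) (b : ℕ) (F G : Finset (Finset ℕ)) (h : goodPair S b F G)
    (hmax : ∀ F' G', goodPair S b F' G' → F'.card + G'.card ≤ F.card + G.card)
    (hmin : ∀ F' G', goodPair S b F' G' → F'.card + G'.card = F.card + G.card →
        G.card ≤ G'.card) (x y : ℕ) (hx : x ∈ S) (hy : y ∈ S) (B' : Finset ℕ)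
    (hB' : B' ∈ G) (hfix : sw x y B' = B') : ∀ B ∈ G, sw x y B ∈ G := by
  obtain ⟨hF, hG, hX, hFne, hGne⟩ := h
  have hGF : G.card ≤ F.card :=
    hmin G F ⟨hG, hF, cross_symm hX, hGne, hFne⟩ (Nat.add_comm _ _)
  have hX' := swf_cross (x := x) (y := y) hX
  have hF' := swf_sub hx hy hF
  have hG' := swf_sub hx hy hG
  have cF := swf_card x y F
  have cG := swf_card x y G
  set F' := swf x y F
  set G' := swf x y G
  have hB'' : B' ∈ G' := Finset.mem_image.2 ⟨B', hB', hfix⟩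
  have hint : B' ∈ G ∩ G' := Finset.mem_inter.2 ⟨hB', hB''⟩
  have p1 : goodPair S b (F ∪ F') (G ∩ G') := by
    refine ⟨Finset.union_subset hF hF', Finset.inter_subset_left.trans hG, ?_,
      hFne.mono Finset.subset_union_left, ⟨B', hint⟩⟩
    intro A hA B hB
    rw [Finset.mem_inter] at hB
    rcases Finset.mem_union.1 hA with hA | hA
    · exact hX A hA B hB.1
    · exact hX' A hA B hB.2
  have cF2 := Finset.card_union_add_card_inter F F'
  have cG2 := Finset.card_union_add_card_inter G G'
  have cpos : 0 < (G ∩ G').card := Finset.card_pos.2 ⟨B', hint⟩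
  have m1 := hmax _ _ p1
  have m2 := hmin _ _ p1
  have key : G.card ≤ (G ∩ G').card := by
    by_contra hlt
    have hne : (F ∪ F').card + (G ∩ G').card ≠ F.card + G.card := fun h => hlt (m2 h)
    by_cases hFF : (F ∩ F').Nonempty
    · have p2 : goodPair S b (F ∩ F') (G ∪ G') := by
        refine ⟨Finset.inter_subset_left.trans hF, Finset.union_subset hG hG', ?_,
          hFF, hGne.mono Finset.subset_union_left⟩
        intro A hA B hB
        rw [Finset.mem_inter] at hA
        rcases Finset.mem_union.1 hB with hB | hB
        · exact hX A hA.1 B hB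
        · exact hX' A hA.2 B hB
      have m3 := hmax _ _ p2
      omega
    · rw [Finset.not_nonempty_iff_eq_empty] at hFF
      rw [hFF] at cF2
      simp at cF2
      omega
  have e1 : G ∩ G' = G := Finset.eq_of_subset_of_card_le Finset.inter_subset_left key
  have e2 : G ⊆ G' := Finset.inter_eq_left.1 e1
  have e3 : G = G' := Finset.eq_of_subset_of_card_le e2 (by omega)
  intro B hB
  rw [e3]
  exact Finset.mem_image_of_mem _ hB

lemma exists_notMem_union (S A B : Finset ℕ) (b : ℕ) (hA : A.card = b) (hB : B.card = b)
    (hn : 2 * b < S.card) : ∃ y ∈ S, y ∉ A ∧ y ∉ B := by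
  by_contra hcon
  push Not at hcon
  have : S ⊆ A ∪ B := by
    intro y hy
    rw [Finset.mem_union]
    by_contra h
    push Not at h
    exact h.2 (hcon y hy h.1)
  have := Finset.card_le_card this
  have := Finset.card_union_le A B
  omega

lemma sw_sw (x y : ℕ) (B : Finset ℕ) : sw x y (sw x y B) = B := by
  ext z; simp [mem_sw]

lemma extremal_card_one (S : Finset ℕ) (b : ℕ) (hn : 2 * b < S.card)
    (F G : Finset (Finset ℕ)) (h : goodPair S b F G)
    (hblock : ∀ x ∈ S, ∀ y ∈ S, ∀ B' ∈ G, sw x y B' = B' → ∀ B ∈ G, sw x y B ∈ G) :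
    G.card ≤ 1 := by
  obtain ⟨hF, hG, hX, ⟨A, hA⟩, hGne⟩ := h
  have hAc := (Finset.mem_powersetCard.1 (hF hA)).2
  by_contra hlt
  obtain ⟨B1, hB1, B2, hB2, hne⟩ := Finset.one_lt_card.1 (by omega : 1 < G.card)
  have hcard : ∀ B ∈ G, B.card = b := fun B hB => (Finset.mem_powersetCard.1 (hG hB)).2
  have hsub : ∀ B ∈ G, B ⊆ S := fun B hB => (Finset.mem_powersetCard.1 (hG hB)).1
  -- property: some neighbour of `B` is in `G`
  let W := G.filter (fun B => ∃ x ∈ B, ∃ y ∈ S, y ∉ B ∧ sw x y B ∈ G)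
  have hWne : W.Nonempty := by
    obtain ⟨x, hx, hx2⟩ : ∃ x ∈ B1, x ∉ B2 := by
      by_contra hcon
      push Not at hcon
      exact hne (Finset.eq_of_subset_of_card_le hcon (by rw [hcard _ hB1, hcard _ hB2]))
    obtain ⟨y, hyS, hy1, hy2⟩ := exists_notMem_union S B1 B2 b (hcard _ hB1) (hcard _ hB2) hn
    refine ⟨B1, Finset.mem_filter.2 ⟨hB1, x, hx, y, hyS, hy1, ?_⟩⟩
    exact hblock x (hsub _ hB1 hx) y hyS B2 hB2 (sw_fix (by simp [hx2, hy2])) B1 hB1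
  obtain ⟨B, hBW, hBmin⟩ := Finset.exists_min_image W (fun B => (B ∩ A).card) hWne
  obtain ⟨hBG, x, hxB, y, hyS, hyB, hxy⟩ := Finset.mem_filter.1 hBW
  have hxS := hsub _ hBG hxB
  obtain ⟨u, hu⟩ := hX A hA B hBG
  obtain ⟨huA, huB⟩ := Finset.mem_inter.1 hu
  have huS := hsub _ hBG huB
  obtain ⟨v, hvS, hvA, hvB⟩ := exists_notMem_union S A B b hAc (hcard _ hBG) hn
  -- all neighbours
  have n1 : sw x v B ∈ G := by
    have := hblock y hyS v hvS B hBG (sw_fix (by simp [hyB, hvB])) _ hxy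
    convert this using 1
    ext z
    simp only [mem_sw, Equiv.swap_apply_def]
    grind
  have n2 : sw u v B ∈ G := by
    have := hblock x hxS u huS B hBG (sw_fix (by simp [hxB, huB])) _ n1
    convert this using 1
    ext z
    simp only [mem_sw, Equiv.swap_apply_def]
    grind
  have n3 : sw u v B ∈ W := by
    refine Finset.mem_filter.2 ⟨n2, v, ?_, u, huS, ?_, ?_⟩
    · rw [mem_sw]; simpa using huB
    · rw [mem_sw]; simpa using hvB
    · have : sw v u (sw u v B) = B := by
        ext z; simp only [mem_sw, Equiv.swap_comm v u]; simp
      rw [this]; exact hBG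
  have := hBmin _ n3
  have hlt : (sw u v B ∩ A).card < (B ∩ A).card := by
    apply Finset.card_lt_card
    rw [Finset.ssubset_iff_of_subset]
    · refine ⟨u, by simp [huA, huB], ?_⟩
      rw [Finset.mem_inter, mem_sw]
      simp [hvB]
    · intro z hz
      rw [Finset.mem_inter, mem_sw, Equiv.swap_apply_def] at hz
      rw [Finset.mem_inter]
      grind
  omega

lemma base_eq (S : Finset ℕ) (b : ℕ) (F G : Finset (Finset ℕ))
    (hn : b + b ≤ S.card) (hF : F ⊆ S.powersetCard b) (hG : G ⊆ S.powersetCard b)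
    (hX : crossInt F G) (hFne : F.Nonempty) (hGne : G.Nonempty) :
    (F.card : ℤ) + G.card ≤ (S.card.choose b : ℤ) - ((S.card - b).choose b : ℤ) + 1 := by
  rcases Nat.eq_or_lt_of_le hn with hn | hn
  · -- complements
    have e : S.card - b = b := by omega
    rw [e, Nat.choose_self]
    let G' := G.image (fun B => S \ B)
    have hG'c : G'.card = G.card := by
      apply Finset.card_image_of_injOn
      intro B hB B2 hB2 h
      have h' : S \ B = S \ B2 := h
      have s1 := (Finset.mem_powersetCard.1 (hG hB)).1
      have s2 := (Finset.mem_powersetCard.1 (hG hB2)).1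
      rw [← Finset.sdiff_sdiff_eq_self s1, ← Finset.sdiff_sdiff_eq_self s2, h']
    have hd : Disjoint F G' := by
      rw [Finset.disjoint_left]
      intro A hA hA'
      obtain ⟨B, hB, rfl⟩ := Finset.mem_image.1 hA'
      have := hX _ hA B hB
      simp at this
    have hs : F ∪ G' ⊆ S.powersetCard b := by
      apply Finset.union_subset hF
      intro A hA
      obtain ⟨B, hB, rfl⟩ := Finset.mem_image.1 hA
      have := Finset.mem_powersetCard.1 (hG hB)
      rw [Finset.mem_powersetCard]
      exact ⟨Finset.sdiff_subset, by rw [Finset.card_sdiff_of_subset this.1]; omega⟩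
    have := Finset.card_le_card hs
    rw [Finset.card_union_of_disjoint hd, hG'c, Finset.card_powersetCard] at this
    have : (F.card : ℤ) + G.card ≤ (S.card.choose b : ℤ) := by exact_mod_cast this
    push_cast
    linarith
  · obtain ⟨F1, G1, hp, hmax, hmin⟩ := exists_extremal S b F G ⟨hF, hG, hX, hFne, hGne⟩
    have h1 := extremal_card_one S b (by omega) F1 G1 hp
      (fun x hx y hy B' hB' hf => block_prop S b F1 G1 hp hmax hmin x y hx hy B' hB' hf)
    have h2 := hmax F G ⟨hF, hG, hX, hFne, hGne⟩
    obtain ⟨hF1, hG1, hX1, _, ⟨B0, hB0⟩⟩ := hp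
    have hB0' := Finset.mem_powersetCard.1 (hG1 hB0)
    have h3 := card_meeting S B0 b hB0'.1
    have h4 : F1 ⊆ (S.powersetCard b).filter (fun A => (A ∩ B0).Nonempty) :=
      fun A hA => Finset.mem_filter.2 ⟨hF1 hA, hX1 A hA B0 hB0⟩
    have h5 := Finset.card_le_card h4
    rw [hB0'.2] at h3
    have h6 : F.card + G.card + (S.card - b).choose b ≤ S.card.choose b + 1 := by omega
    have h7 : (F.card : ℤ) + G.card + ((S.card - b).choose b : ℤ)
        ≤ (S.card.choose b : ℤ) + 1 := by exact_mod_cast h6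
    linarith

/-! ### The main bound -/

lemma boundR (b : ℕ) (hb : 1 ≤ b) (k : ℕ) : ∀ (S : Finset ℕ) (a : ℕ) (F G : Finset (Finset ℕ)),
    b + k ≤ a → a + b ≤ S.card → (k+1) * b ≤ S.card →
    F ⊆ S.powersetCard a → G ⊆ S.powersetCard b → crossInt F G → F.Nonempty →
    cov (k+1) G → (F.card : ℤ) + G.card ≤ MM b (k+1) S.card a + (k+1) := by
  induction k with
  | zero =>
    intro S a F G hba hn1 hn2 hF hG hX hFne hc
    have hGne := cov_nonempty hc
    rw [MM_succ, MM_zero, MM_zero]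
    rcases Nat.eq_or_lt_of_le hba with h | h
    · have e : a = b := by omega
      subst e
      have := base_eq S a F G hn1 hF hG hX hFne hGne
      push_cast; linarith
    · have := base_lt S a b F G (by omega) hn1 hF hG hX hGne
      push_cast; linarith
  | succ k ih =>
    intro S a F G hba hn1 hn2 hF hG hX hFne hc
    have hkb : (k+1+1) * b = (k+1) * b + b := Nat.succ_mul (k+1) b
    obtain ⟨A0, hA0⟩ := hFne
    obtain ⟨B0, hB0⟩ := cov_nonempty hc
    obtain ⟨x, hx⟩ := hX A0 hA0 B0 hB0
    obtain ⟨hxA, hxB⟩ := Finset.mem_inter.1 hx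
    have hxS := (Finset.mem_powersetCard.1 (hF hA0)).1 hxA
    have hcard := Finset.card_erase_of_mem hxS
    obtain ⟨a, rfl⟩ : ∃ a', a = a' + 1 := ⟨a - 1, by omega⟩
    have hs : ∀ B ∈ G, B.card ≤ b := fun B hB => (Finset.mem_powersetCard.1 (hG hB)).2.le
    have h1 := ih (S.erase x) a (lnk x F) (del x G) (by omega) (by omega) (by omega)
      (lnk_sub hF) (del_sub hG) (cross_lnk_del hX) ⟨_, mem_lnk.2 ⟨A0, hA0, hxA, rfl⟩⟩
      (cov_del hc)
    have h2 := boundP b (k+1) (b-1) (S.erase x) (a+1) (del x F) (trc x G) (lnk x G)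
      (by omega) (by omega) (by omega) (by omega) (del_sub hF) (lnk_sub hG) lnk_sub_trc
      ⟨_, mem_lnk.2 ⟨B0, hB0, hxB, rfl⟩⟩ (cross_del_trc hX) (size_trc hs) (cov_trc hc)
    have h3 := card_lnk_del x F
    have h4 := card_lnk_del x G
    rw [hcard] at h1 h2
    rw [MM_succ b (k+1)]
    obtain ⟨N, hN⟩ : ∃ N, S.card = N + 1 := ⟨S.card - 1, by omega⟩
    rw [hN] at h1 h2 ⊢
    have e1 : N + 1 - 1 = N := rfl
    have e2 : N + 1 - b = N - (b - 1) := by omega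
    rw [e1] at h1 h2
    rw [e2, MM_pascal b (k+1) N a (by omega), ← h3, ← h4]
    push_cast at h1 ⊢
    linarith

theorem stmt0 (n a b t : ℕ) (hn : 1 ≤ n) (ha : 1 ≤ a) (hb : 2 ≤ b) (ht : 1 ≤ t)
    (habt : b + t ≤ a + 1) (hnab : a + b ≤ n) (hnbt : b * t ≤ n)
    (F G : Finset (Finset ℕ))
    (hF : F ⊆ (Finset.Icc 1 n).powersetCard a)
    (hG : G ⊆ (Finset.Icc 1 n).powersetCard b)
    (hcross : crossInt F G)
    (hFne : F.Nonempty)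
    (hGcov : coverGE n t G) :
    (F.card : ℤ) + G.card ≤ MtSize n a b t := by
  obtain ⟨k, rfl⟩ : ∃ k, t = k + 1 := ⟨t - 1, by omega⟩
  have hS : (Finset.Icc 1 n).card = n := by simp
  have hc : cov (k+1) G := by
    intro T hT
    refine (hGcov (T ∩ Finset.Icc 1 n) Finset.inter_subset_right ?_).trans
      (Finset.card_le_card Finset.inter_subset_left)
    intro B hB
    obtain ⟨z, hz⟩ := hT B hB
    rw [Finset.mem_inter] at hz
    have := (Finset.mem_powersetCard.1 (hG hB)).1 hz.2
    exact ⟨z, by rw [Finset.mem_inter, Finset.mem_inter]; exact ⟨⟨hz.1, this⟩, hz.2⟩⟩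
  have := boundR b (by omega) k (Finset.Icc 1 n) a F G (by omega) (by omega)
    (by rw [hS, Nat.mul_comm]; exact hnbt) hF hG hcross hFne hc
  rw [hS] at this
  rw [MtSize_eq]
  push_cast
  exact this
end

section
/- Let n, a, b, s, t be positive integers with a ≥ b + t - 1, b ≥ 2, t ≥ 2 and n ≥ max{a+b, bt}. Suppose F ⊆ C([n],a) and G ⊆ C([n],b) are cross-intersecting families with τ(F) = s and τ(G) ≥ t. Then |F| + |G| ≤ Σ_{i=1}^{s} ( C(n-i, a-1) + Σ_{j=1}^{t-1} (-1)^j · C(t-1, j) · C(n-jb-i, a-1) ) + C(n-s, b-s) + t - 1. -/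
open Finset

lemma choose_half_mono {m c k : ℕ} (h : c ≤ k) (hk : k ≤ m / 2) : m.choose c ≤ m.choose k := by
  induction k, h using Nat.le_induction with
  | base => rfl
  | succ k _ ih =>
    exact (ih (by omega)).trans (Nat.choose_le_succ_of_lt_half_left (by omega))

/-- Number of `k`-subsets of an `m`-set that hit disjoint blocks of the given sizes. -/
def hcL : ℕ → ℕ → List ℕ → ℤ
  | m, k, [] => (m.choose k : ℤ)
  | m, k, b :: l => hcL m k l - hcL (m - b) k l

lemma hcL_pascal (l : List ℕ) : ∀ m k : ℕ, l.sum ≤ m →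
    hcL (m + 1) (k + 1) l = hcL m k l + hcL m (k + 1) l := by
  induction l with
  | nil => intro m k _; simp [hcL, Nat.choose_succ_succ]
  | cons b l ih =>
    intro m k h
    simp only [List.sum_cons] at h
    have e : m + 1 - b = (m - b) + 1 := by omega
    simp only [hcL]
    rw [e, ih m k (by omega), ih (m - b) k (by omega)]
    ring

lemma hcL_zero (l : List ℕ) : ∀ m k : ℕ, m < k → hcL m k l = 0 := by
  induction l with
  | nil => intro m k h; simp [hcL, Nat.choose_eq_zero_of_lt h]
  | cons b l ih =>
    intro m k h
    simp only [hcL]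
    rw [ih m k h, ih (m - b) k (by omega)]; ring

lemma hcL_k_zero (l : List ℕ) (m : ℕ) : hcL m 0 l = if l = [] then 1 else 0 := by
  induction l generalizing m with
  | nil => simp [hcL]
  | cons b l ih => simp [hcL, ih]

/-- split on an element of the first block -/
lemma hcL_split (m k b : ℕ) (l : List ℕ) (h : b + l.sum ≤ m) :
    hcL (m + 1) (k + 1) ((b + 1) :: l) = hcL m k l + hcL m (k + 1) (b :: l) := by
  simp only [hcL]
  rw [hcL_pascal l m k (by omega)]
  have e : m + 1 - (b + 1) = m - b := by omega
  rw [e]; ring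

lemma hcL_nonneg (m : ℕ) : ∀ (k : ℕ) (l : List ℕ), l.sum ≤ m → 0 ≤ hcL m k l := by
  induction m with
  | zero =>
    intro k l h
    cases l with
    | nil => simp [hcL]
    | cons b l => simp only [hcL, Nat.zero_sub]; simp
  | succ m ih =>
    intro k l h
    cases l with
    | nil => simp [hcL]
    | cons b l =>
      simp only [List.sum_cons] at h
      cases b with
      | zero => simp [hcL]
      | succ b =>
        cases k with
        | zero => rw [hcL_k_zero]; split_ifs <;> simp
        | succ k =>
          rw [hcL_split m k b l (by omega)]
          have h1 := ih k l (by omega)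
          have h2 := ih (k + 1) (b :: l) (by simp only [List.sum_cons]; omega)
          omega

lemma hcL_lower (m : ℕ) : ∀ (k c : ℕ) (l : List ℕ), l.sum ≤ m → (∀ b ∈ l, c + 1 ≤ b) →
    c + l.length ≤ k → k + c ≤ m → (m.choose c : ℤ) ≤ hcL m k l := by
  induction m with
  | zero =>
    intro k c l h hl h1 h2
    have hk : k = 0 := by omega
    have hl : l = [] := by
      cases l with
      | nil => rfl
      | cons b l => simp at h1; omega
    have hc : c = 0 := by omega
    subst hk hl hc
    simp [hcL]
  | succ m ih =>
    intro k c l h hl h1 h2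
    cases l with
    | nil =>
      simp only [hcL]
      norm_cast
      simp at h1
      rw [← Nat.choose_symm (show c ≤ m + 1 by omega)]
      by_cases hck : k ≤ (m + 1) / 2
      · rw [Nat.choose_symm (show c ≤ m + 1 by omega)]
        exact choose_half_mono h1 hck
      · rw [Nat.choose_symm (show c ≤ m + 1 by omega), ← Nat.choose_symm (show k ≤ m + 1 by omega)]
        exact choose_half_mono (by omega) (by omega)
    | cons b l =>
      simp only [List.sum_cons] at h
      simp only [List.length_cons] at h1
      have hb := hl b (by simp)
      obtain ⟨b, rfl⟩ : ∃ b', b = b' + 1 := ⟨b - 1, by omega⟩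
      obtain ⟨k, rfl⟩ : ∃ k', k = k' + 1 := ⟨k - 1, by omega⟩
      rw [hcL_split m k b l (by omega)]
      have e1 := ih k c l (by omega) (fun x hx => hl x (by simp [hx])) (by omega) (by omega)
      cases c with
      | zero =>
        have := hcL_nonneg m (k + 1) (b :: l) (by simp only [List.sum_cons]; omega)
        simp at e1 ⊢
        omega
      | succ c =>
        have e2 := ih (k + 1) c (b :: l) (by simp only [List.sum_cons]; omega)
          (fun x hx => by
            rcases List.mem_cons.1 hx with rfl | hx
            · omega
            · have := hl x (by simp [hx]); omega) (by simp only [List.length_cons]; omega) (by omega)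
        rw [Nat.choose_succ_succ]
        push_cast
        simp only [Nat.succ_eq_add_one]
        omega

lemma hcL_small (m k b r : ℕ) (h : m < k + b) (hb : b ≤ m) :
    hcL m k (List.replicate r b) = m.choose k := by
  induction r with
  | zero => simp [hcL]
  | succ r ih =>
    simp only [List.replicate_succ, hcL]
    rw [ih, hcL_zero _ (m - b) k (by omega)]; ring

lemma hcL_telescope (l : List ℕ) (k m : ℕ) : ∀ b : ℕ, b + l.sum ≤ m →
    ∑ i ∈ Finset.Icc 1 b, hcL (m - i) k l = hcL m (k + 1) (b :: l) := by
  intro b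
  induction b with
  | zero => intro _; simp [hcL]
  | succ b ih =>
    intro h
    rw [Finset.sum_Icc_succ_top (by omega), ih (by omega)]
    simp only [hcL]
    have := hcL_pascal l (m - (b + 1)) k (by omega)
    rw [show m - (b + 1) + 1 = m - b by omega] at this
    rw [this]; ring

lemma hcL_formula (k b : ℕ) : ∀ r m : ℕ, hcL m k (List.replicate r b) =
    ∑ j ∈ Finset.range (r + 1), (-1 : ℤ) ^ j * (r.choose j : ℤ) * ((m - j * b).choose k : ℤ) := by
  intro r
  induction r with
  | zero => intro m; simp [hcL]
  | succ r ih =>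
    intro m
    simp only [List.replicate_succ, hcL]
    rw [ih, ih, Finset.sum_range_succ' _ (r + 1), Finset.sum_range_succ' _ r]
    have key : ∀ j ∈ Finset.range (r + 1), (-1 : ℤ) ^ (j + 1) * ((r + 1).choose (j + 1) : ℤ) *
        ((m - (j + 1) * b).choose k : ℤ) =
        (-1 : ℤ) ^ (j + 1) * (r.choose (j + 1) : ℤ) * ((m - (j + 1) * b).choose k : ℤ)
        - (-1 : ℤ) ^ j * (r.choose j : ℤ) * ((m - b - j * b).choose k : ℤ) := by
      intro j _
      rw [Nat.choose_succ_succ, show m - b - j * b = m - (j + 1) * b by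
        rw [Nat.sub_sub]; congr 1; ring]
      push_cast; ring
    rw [Finset.sum_congr rfl key, Finset.sum_sub_distrib,
      Finset.sum_range_succ (fun j => (-1 : ℤ) ^ (j + 1) * (r.choose (j + 1) : ℤ) *
        ((m - (j + 1) * b).choose k : ℤ)) r]
    simp
    ring

lemma Mst_eq (n a b s t : ℕ) : MstSize n a b s t =
    ∑ i ∈ Finset.Icc 1 s, hcL (n - i) (a - 1) (List.replicate (t - 1) b) +
      ((n - s).choose (b - s) : ℤ) + (t : ℤ) - 1 := by
  unfold MstSize
  congr 3
  apply Finset.sum_congr rfl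
  intro i _
  rw [hcL_formula, Finset.sum_range_succ', add_comm]
  congr 1
  · rw [← Finset.sum_image (s := Finset.range (t - 1)) (g := fun j => j + 1)
      (f := fun j => (-1 : ℤ) ^ j * ((t - 1).choose j : ℤ) * ((n - i - j * b).choose (a - 1) : ℤ))
      (by intro x _ y _ h; simpa using h)]
    have : (Finset.range (t - 1)).image (fun j => j + 1) = Finset.Icc 1 (t - 1) := by
      ext x; simp only [Finset.mem_image, Finset.mem_range, Finset.mem_Icc]
      constructor
      · rintro ⟨y, hy, rfl⟩; omega
      · intro h; exact ⟨x - 1, by omega, by omega⟩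
    rw [this]
    apply Finset.sum_congr rfl
    intro j _
    rw [Nat.sub_right_comm]
  · simp

section fam
variable {ι : Type*} [DecidableEq ι]

lemma link_sub {V : Finset ι} {F : Finset (Finset ι)} {a : ℕ} (x : ι)
    (hF : F ⊆ V.powersetCard a) : F.memberSubfamily x ⊆ (V.erase x).powersetCard (a - 1) := by
  intro A hA
  rw [mem_memberSubfamily] at hA
  have := mem_powersetCard.1 (hF hA.1)
  rw [card_insert_of_notMem hA.2] at this
  rw [mem_powersetCard]
  refine ⟨fun y hy => mem_erase.2 ⟨fun h => hA.2 (h ▸ hy), this.1 (mem_insert_of_mem hy)⟩, by omega⟩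

lemma del_sub_s2 {V : Finset ι} {F : Finset (Finset ι)} {a : ℕ} (x : ι)
    (hF : F ⊆ V.powersetCard a) : F.nonMemberSubfamily x ⊆ (V.erase x).powersetCard a := by
  intro A hA
  rw [mem_nonMemberSubfamily] at hA
  have := mem_powersetCard.1 (hF hA.1)
  rw [mem_powersetCard]
  exact ⟨fun y hy => mem_erase.2 ⟨fun h => hA.2 (h ▸ hy), this.1 hy⟩, this.2⟩

/-- cross-intersecting -/
def CI (F G : Finset (Finset ι)) : Prop := ∀ A ∈ F, ∀ B ∈ G, (A ∩ B).Nonempty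

lemma CI.symm {F G : Finset (Finset ι)} (h : CI F G) : CI G F := fun A hA B hB => by
  rw [inter_comm]; exact h B hB A hA

lemma CI.link_del {F G : Finset (Finset ι)} (h : CI F G) (x : ι) :
    CI (F.memberSubfamily x) (G.nonMemberSubfamily x) := by
  intro A hA B hB
  rw [mem_memberSubfamily] at hA
  rw [mem_nonMemberSubfamily] at hB
  have := h _ hA.1 _ hB.1
  rwa [insert_inter_of_notMem hB.2] at this

lemma CI.del_link {F G : Finset (Finset ι)} (h : CI F G) (x : ι) :
    CI (F.nonMemberSubfamily x) (G.memberSubfamily x) := (h.symm.link_del x).symm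

lemma choose_le_choose_of {m k c : ℕ} (h : c ≤ k) (h2 : k + c ≤ m) : m.choose c ≤ m.choose k := by
  have := hcL_lower m k c [] (by simp) (by simp) (by simpa using h) h2
  simpa [hcL] using this

lemma NM {V : Finset ι} {F G : Finset (Finset ι)} {a b : ℕ} (hF : F ⊆ V.powersetCard a)
    (hG : G ⊆ V.powersetCard b) (h : CI F G) (hba : b ≤ a) (hV : a + b ≤ V.card) :
    F.card + G.card ≤ V.card.choose a := by
  set N := (V.powersetCard a).filter (fun A => ∃ B ∈ G, Disjoint A B) with hN
  have hdis : Disjoint F N := by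
    rw [disjoint_left]
    intro A hA hA2
    obtain ⟨B, hB, hd⟩ := (mem_filter.1 hA2).2
    have := h A hA B hB
    rw [disjoint_iff_inter_eq_empty.1 hd] at this
    simp at this
  have hFN : F.card + N.card ≤ V.card.choose a := by
    rw [← card_union_of_disjoint hdis, ← card_powersetCard]
    exact card_le_card (union_subset hF (filter_subset _ _))
  have hGN : G.card * ((V.card - b).choose a) ≤ N.card * ((V.card - a).choose b) := by
    apply card_mul_le_card_mul (fun B A => Disjoint A B)
    · intro B hB
      have hB' := mem_powersetCard.1 (hG hB)
      have : (V \ B).powersetCard a ⊆ N.bipartiteAbove (fun B A => Disjoint A B) B := by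
        intro A hA
        rw [mem_powersetCard, subset_sdiff] at hA
        rw [mem_bipartiteAbove, hN, mem_filter, mem_powersetCard]
        exact ⟨⟨⟨hA.1.1, hA.2⟩, B, hB, hA.1.2⟩, hA.1.2⟩
      have h2 := card_le_card this
      rwa [card_powersetCard, card_sdiff_of_subset hB'.1, hB'.2] at h2
    · intro A hA
      have hA' := mem_powersetCard.1 (mem_filter.1 hA).1
      have : G.bipartiteBelow (fun B A => Disjoint A B) A ⊆ (V \ A).powersetCard b := by
        intro B hB
        rw [mem_bipartiteBelow] at hB
        have := mem_powersetCard.1 (hG hB.1)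
        rw [mem_powersetCard, subset_sdiff]
        exact ⟨⟨this.1, hB.2.symm⟩, this.2⟩
      have h2 := card_le_card this
      rwa [card_powersetCard, card_sdiff_of_subset hA'.1, hA'.2] at h2
  have hch : (V.card - a).choose b ≤ (V.card - b).choose a := by
    rw [← Nat.choose_symm (show b ≤ V.card - a by omega),
      ← Nat.choose_symm (show a ≤ V.card - b by omega), Nat.sub_sub, Nat.sub_sub, add_comm b a]
    exact Nat.choose_le_choose _ (by omega)
  have hpos : 0 < (V.card - a).choose b := Nat.choose_pos (by omega)
  have : G.card ≤ N.card := by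
    apply Nat.le_of_mul_le_mul_right _ hpos
    exact (Nat.mul_le_mul_left _ hch).trans hGN
  omega

lemma HM1 (b : ℕ) : ∀ {V : Finset ι} {F G : Finset (Finset ι)} {a : ℕ}, F ⊆ V.powersetCard a →
    G ⊆ V.powersetCard b → CI F G → b < a → a + b ≤ V.card → G.Nonempty →
    F.card + G.card + (V.card - b).choose a ≤ V.card.choose a + 1 := by
  induction b with
  | zero =>
    intro V F G a hF hG h hba hV hne
    obtain ⟨B, hB⟩ := hne
    have hB0 := mem_powersetCard.1 (hG hB)
    have hFe : F = ∅ := by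
      rw [eq_empty_iff_forall_notMem]
      intro A hA
      have := h A hA B hB
      rw [card_eq_zero.1 hB0.2] at this
      simp at this
    have := card_le_card hG
    simp at this
    simp [hFe]
    omega
  | succ b ih =>
    intro V F G a hF hG h hba hV hne
    obtain ⟨B, hB⟩ := hne
    have hB0 := mem_powersetCard.1 (hG hB)
    obtain ⟨x, hx⟩ : B.Nonempty := card_pos.1 (by omega)
    have hxV := hB0.1 hx
    have hVc := card_erase_of_mem hxV
    have h1 := NM (link_sub x hF) (del_sub_s2 x hG) (h.link_del x) (by omega) (by omega)
    have h2 := ih (del_sub_s2 x hF) (link_sub x hG) (h.del_link x) (by omega) (by omega)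
      ⟨B.erase x, by rw [mem_memberSubfamily, insert_erase hx]; simp [hB]⟩
    have e1 := card_memberSubfamily_add_card_nonMemberSubfamily x F
    have e2 := card_memberSubfamily_add_card_nonMemberSubfamily x G
    obtain ⟨m, hm⟩ : ∃ m, V.card = m + 1 := ⟨V.card - 1, by omega⟩
    obtain ⟨a, rfl⟩ : ∃ a', a = a' + 1 := ⟨a - 1, by omega⟩
    rw [hVc, hm] at h1 h2
    rw [hm, Nat.choose_succ_succ]
    simp only [Nat.add_sub_cancel] at h1 h2
    rw [show m + 1 - (b + 1) = m - b by omega]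
    simp only [Nat.succ_eq_add_one]
    omega

end fam
section KK
open scoped FinsetFamily
open Finset.Colex

lemma exists_initSeg_card {n r : ℕ} (c : ℕ) (hc : c ≤ n.choose r) :
    ∃ C : Finset (Finset (Fin n)), IsInitSeg C r ∧ C.card = c := by
  induction c with
  | zero => exact ⟨∅, isInitSeg_empty, by simp⟩
  | succ c ih =>
    obtain ⟨C, hC, hcard⟩ := ih (by omega)
    have hsub : C ⊆ powersetCard r univ := fun A hA =>
      mem_powersetCard.2 ⟨subset_univ _, hC.1 hA⟩
    have hne : (powersetCard r univ \ C).Nonempty := by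
      rw [← card_pos, card_sdiff_of_subset hsub, card_powersetCard, card_univ, Fintype.card_fin]
      omega
    obtain ⟨S, hS, hmin⟩ := exists_min_image _ (fun A => toColex A) hne
    rw [mem_sdiff, mem_powersetCard] at hS
    refine ⟨insert S C, ⟨?_, ?_⟩, by rw [card_insert_of_notMem hS.2, hcard]⟩
    · intro A hA
      simp only [coe_insert, Set.mem_insert_iff, mem_coe] at hA
      rcases hA with rfl | hA
      · exact hS.1.2
      · exact hC.1 hA
    · intro A B hA hB
      rw [mem_insert] at hA ⊢
      rcases hA with rfl | hA
      · right
        by_contra hBC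
        have := hmin B (by rw [mem_sdiff, mem_powersetCard]; exact ⟨⟨subset_univ _, hB.2⟩, hBC⟩)
        exact absurd hB.1 (not_lt.2 this)
      · right; exact hC.2 hA hB

lemma isInitSeg_erase_last (m r : ℕ) :
    IsInitSeg (powersetCard r ((univ : Finset (Fin (m + 1))).erase (Fin.last m))) r := by
  refine ⟨Set.sized_powersetCard _ _, ?_⟩
  intro A B hA hB
  rw [mem_powersetCard] at hA ⊢
  refine ⟨fun x hx => ?_, hB.2⟩
  have := forall_lt_mono hB.1.le (a := Fin.last m) (fun y hy => by
    have := hA.1 hy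
    rw [mem_erase] at this
    exact Fin.lt_last_iff_ne_last.2 this.1) x hx
  rw [mem_erase]
  exact ⟨this.ne, mem_univ _⟩

lemma EQ_fin_aux (m a : ℕ) (ha : 1 ≤ a) (hm : 2 * a ≤ m + 1)
    {F G : Finset (Finset (Fin (m + 1)))} (hF : F ⊆ powersetCard a univ)
    (hG : G ⊆ powersetCard a univ) (h : CI F G) (hGn : G.Nonempty) (hGF : G.card ≤ F.card) :
    F.card + G.card + (m + 1 - a).choose a ≤ (m + 1).choose a + 1 := by
  set N := ∂^[m + 1 - 2 * a] Gᶜˢ with hN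
  have hGs : (G : Set (Finset (Fin (m + 1)))).Sized a := fun A hA => (mem_powersetCard.1 (hG hA)).2
  have hGbar : (Gᶜˢ : Set (Finset (Fin (m + 1)))).Sized (m + 1 - a) := by
    simpa using hGs.compls
  have hNs : N ⊆ powersetCard a univ := by
    intro A hA
    rw [mem_powersetCard]
    refine ⟨subset_univ _, ?_⟩
    have : (N : Set (Finset (Fin (m + 1)))).Sized (m + 1 - a - (m + 1 - 2 * a)) :=
      hGbar.shadow_iterate
    have := this hA
    omega
  have hdis : Disjoint F N := disjoint_right.2 fun A hAbar hA ↦ by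
    simp only [hN, mem_shadow_iterate_iff_exists_sdiff, mem_compls] at hAbar
    obtain ⟨C, hC, hAC, _⟩ := hAbar
    have := h A hA _ hC
    obtain ⟨x, hx⟩ := this
    rw [mem_inter, mem_compl] at hx
    exact hx.2 (hAC hx.1)
  have hFN : F.card + N.card ≤ (m + 1).choose a := by
    rw [← card_union_of_disjoint hdis]
    have := card_le_card (union_subset hF hNs)
    simpa using this
  have hpas : (m + 1).choose a = m.choose (a - 1) + m.choose a := by
    obtain ⟨a, rfl⟩ : ∃ a', a = a' + 1 := ⟨a - 1, by omega⟩
    simp [Nat.choose_succ_succ]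
  have hsymm : m.choose (a - 1) = m.choose (m + 1 - a) := by
    rw [← Nat.choose_symm (show a - 1 ≤ m by omega)]
    congr 1; omega
  have hGc : G.card ≤ m.choose (m + 1 - a) := by
    by_contra hlt
    push Not at hlt
    have kk := kruskal_katona_lovasz_form (i := m + 1 - 2 * a) (r := m + 1 - a) (k := m)
      (by omega) (by omega) (by omega) hGbar (by rw [card_compls]; exact hlt.le)
    rw [show m + 1 - a - (m + 1 - 2 * a) = a by omega, ← hN] at kk
    omega
  obtain ⟨C, hC, hCc⟩ := exists_initSeg_card (n := m + 1) (r := m + 1 - a) G.card (by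
    exact hGc.trans (Nat.choose_le_choose _ (by omega)))
  set V' := (univ : Finset (Fin (m + 1))).erase (Fin.last m) with hV'
  have hV'c : V'.card = m := by rw [hV', card_erase_of_mem (mem_univ _)]; simp
  have hCP : C ⊆ powersetCard (m + 1 - a) V' := by
    rcases hC.total (isInitSeg_erase_last m (m + 1 - a)) with h1 | h1
    · exact h1
    · rw [eq_of_subset_of_card_le h1 (by rw [card_powersetCard, hV'c, hCc]; exact hGc)]
  have kk : (∂^[m + 1 - 2 * a] C).card ≤ N.card :=
    iterated_kk hGbar (by rw [card_compls, hCc]) hC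
  set G' := C.image (fun A => V' \ A) with hG'
  have hG'c : G'.card = G.card := by
    rw [hG', card_image_of_injOn, hCc]
    intro A hA B hB hAB
    have h1 := (mem_powersetCard.1 (hCP hA)).1
    have h2 := (mem_powersetCard.1 (hCP hB)).1
    simp only at hAB
    rw [← Finset.sdiff_sdiff_eq_self h1, hAB, Finset.sdiff_sdiff_eq_self h2]
  set F' := powersetCard a V' \ ∂^[m + 1 - 2 * a] C with hF'
  have hCI : CI F' G' := by
    intro A hA B hB
    rw [hG', mem_image] at hB
    obtain ⟨D, hD, rfl⟩ := hB
    by_contra hne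
    rw [not_nonempty_iff_eq_empty] at hne
    rw [hF', mem_sdiff, mem_powersetCard] at hA
    apply hA.2
    have hD' := mem_powersetCard.1 (hCP hD)
    have hAD : A ⊆ D := by
      intro x hx
      by_contra hxD
      have : x ∈ A ∩ (V' \ D) := by
        rw [mem_inter, mem_sdiff]; exact ⟨hx, hA.1.1 hx, hxD⟩
      rw [hne] at this
      simp at this
    rw [mem_shadow_iterate_iff_exists_sdiff]
    refine ⟨D, hD, hAD, ?_⟩
    rw [card_sdiff_of_subset hAD, hD'.2, hA.1.2]
    omega
  have key := HM1 (a - 1) (V := V') (F := F') (G := G') (a := a) sdiff_subset (by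
    intro B hB
    rw [hG', mem_image] at hB
    obtain ⟨D, hD, rfl⟩ := hB
    have hD' := mem_powersetCard.1 (hCP hD)
    rw [mem_powersetCard, card_sdiff_of_subset hD'.1, hV'c, hD'.2]
    exact ⟨sdiff_subset, by omega⟩) hCI (by omega) (by omega) (by
      rw [← card_pos, hG'c]; exact card_pos.2 hGn)
  rw [hV'c, hG'c, show m - (a - 1) = m + 1 - a by omega] at key
  have hF'c : m.choose a ≤ F'.card + (∂^[m + 1 - 2 * a] C).card := by
    have : (powersetCard a V').card - (∂^[m + 1 - 2 * a] C).card ≤ F'.card := le_card_sdiff _ _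
    rw [card_powersetCard, hV'c] at this
    omega
  omega

lemma EQ_fin (m a : ℕ) (ha : 1 ≤ a) (hm : 2 * a ≤ m + 1)
    {F G : Finset (Finset (Fin (m + 1)))} (hF : F ⊆ powersetCard a univ)
    (hG : G ⊆ powersetCard a univ) (h : CI F G) (hFn : F.Nonempty) (hGn : G.Nonempty) :
    F.card + G.card + (m + 1 - a).choose a ≤ (m + 1).choose a + 1 := by
  rcases le_total G.card F.card with h1 | h1
  · exact EQ_fin_aux m a ha hm hF hG h hGn h1
  · have := EQ_fin_aux m a ha hm hG hF h.symm hFn h1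
    omega

/-- pull back a family along an embedding -/
def pullF {m : ℕ} (f : Fin m ↪ ℕ) (F : Finset (Finset ℕ)) : Finset (Finset (Fin m)) :=
  univ.filter (fun A => A.map f ∈ F)

lemma pullF_card {m : ℕ} (f : Fin m ↪ ℕ) (F : Finset (Finset ℕ)) (V : Finset ℕ)
    (hf : univ.map f = V) (hF : ∀ A ∈ F, A ⊆ V) : (pullF f F).card = F.card := by
  rw [← card_map (mapEmbedding f).toEmbedding]
  congr 1
  ext A
  simp only [mem_map, pullF, mem_filter, mem_univ, true_and]
  constructor
  · rintro ⟨B, hB, rfl⟩; exact hB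
  · intro hA
    have := hF A hA
    rw [← hf, subset_map_iff] at this
    obtain ⟨B, -, rfl⟩ := this
    exact ⟨B, hA, rfl⟩

lemma EQ {V : Finset ℕ} {a : ℕ} (ha : 1 ≤ a) (hV : 2 * a ≤ V.card)
    {F G : Finset (Finset ℕ)} (hF : F ⊆ V.powersetCard a)
    (hG : G ⊆ V.powersetCard a) (h : CI F G) (hFn : F.Nonempty) (hGn : G.Nonempty) :
    F.card + G.card + (V.card - a).choose a ≤ V.card.choose a + 1 := by
  obtain ⟨m, hm⟩ : ∃ m, V.card = m + 1 := ⟨V.card - 1, by omega⟩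
  let f : Fin (m + 1) ↪ ℕ := (V.orderEmbOfFin hm).toEmbedding
  have hf : univ.map f = V := by
    apply coe_injective
    simp [f]
  have hF' := pullF_card f F V hf (fun A hA => (mem_powersetCard.1 (hF hA)).1)
  have hG' := pullF_card f G V hf (fun A hA => (mem_powersetCard.1 (hG hA)).1)
  have hs : ∀ H : Finset (Finset ℕ), H ⊆ V.powersetCard a → pullF f H ⊆ powersetCard a univ := by
    intro H hH A hA
    have := (mem_powersetCard.1 (hH (mem_filter.1 hA).2)).2
    rw [card_map] at this
    exact mem_powersetCard.2 ⟨subset_univ _, this⟩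
  have key := EQ_fin m a ha (by omega) (hs F hF) (hs G hG) (by
    intro A hA B hB
    have := h _ (mem_filter.1 hA).2 _ (mem_filter.1 hB).2
    rw [← map_inter] at this
    simpa using this) (card_pos.1 (by rw [hF']; exact card_pos.2 hFn))
    (card_pos.1 (by rw [hG']; exact card_pos.2 hGn))
  rw [hF', hG'] at key
  rw [hm]; exact key

end KK
lemma choose_le_choose_of' {m k : ℕ} (h1 : 1 ≤ k) (h2 : k < m) : m ≤ m.choose k := by
  have : m.choose 1 ≤ m.choose k := choose_le_choose_of h1 (by omega)
  simpa using this

/-- covering number at least `r` inside `V` -/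
def CovGE (V : Finset ℕ) (r : ℕ) (G : Finset (Finset ℕ)) : Prop :=
  ∀ T : Finset ℕ, T ⊆ V → (∀ B ∈ G, (T ∩ B).Nonempty) → r ≤ T.card

lemma CovGE.card_le {V : Finset ℕ} {r b : ℕ} {G : Finset (Finset ℕ)} (h : CovGE V r G)
    (hG : G ⊆ V.powersetCard b) (hb : 1 ≤ b) : r ≤ G.card := by
  have hne : ∀ B ∈ G, B.Nonempty := fun B hB =>
    card_pos.1 (by rw [(mem_powersetCard.1 (hG hB)).2]; omega)
  let f : Finset ℕ → ℕ := fun B => if hB : B.Nonempty then hB.choose else 0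
  have hf : ∀ B ∈ G, f B ∈ B := by
    intro B hB
    simp only [f, dif_pos (hne B hB)]
    exact (hne B hB).choose_spec
  refine (h (G.image f) ?_ ?_).trans card_image_le
  · intro x hx
    obtain ⟨B, hB, rfl⟩ := mem_image.1 hx
    exact (mem_powersetCard.1 (hG hB)).1 (hf B hB)
  · intro B hB
    exact ⟨f B, mem_inter.2 ⟨mem_image_of_mem f hB, hf B hB⟩⟩

lemma CovGE.del {V : Finset ℕ} {r : ℕ} {G : Finset (Finset ℕ)} (h : CovGE V (r + 1) G)
    {x : ℕ} (hx : x ∈ V) : CovGE (V.erase x) r (G.nonMemberSubfamily x) := by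
  intro T hT hc
  have := h (insert x T) (insert_subset hx (hT.trans (erase_subset _ _))) (by
    intro B hB
    by_cases hxB : x ∈ B
    · exact ⟨x, by simp [hxB]⟩
    · obtain ⟨y, hy⟩ := hc B (mem_nonMemberSubfamily.2 ⟨hB, hxB⟩)
      rw [mem_inter] at hy
      exact ⟨y, by simp [hy.1, hy.2]⟩)
  have := card_insert_le x T
  omega

/-- the upper bound statement for covering number at least `r` -/
def PP (r : ℕ) : Prop := ∀ (V : Finset ℕ) (F G : Finset (Finset ℕ)) (a b : ℕ), 2 ≤ b →
  b + r ≤ a + 1 → a + b ≤ V.card → b * r ≤ V.card → F ⊆ V.powersetCard a →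
  G ⊆ V.powersetCard b → CI F G → F.Nonempty → CovGE V r G →
  (F.card : ℤ) + G.card ≤ hcL V.card a (List.replicate r b) + r

lemma PP_one : PP 1 := by
  intro V F G a b hb hab hV _ hF hG h hFn hc
  have hGn : G.Nonempty := card_pos.1 (hc.card_le hG (by omega))
  have key : F.card + G.card + (V.card - b).choose a ≤ V.card.choose a + 1 := by
    rcases Nat.lt_or_ge b a with h1 | h1
    · exact HM1 b hF hG h h1 hV hGn
    · obtain rfl : a = b := by omega
      exact EQ (by omega) (by omega) hF hG h hFn hGn
  simp [List.replicate, hcL]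
  omega

/-- upper shadow bound -/
lemma up_bound {V : Finset ℕ} {K : Finset (Finset ℕ)} {k b : ℕ} (hK : K ⊆ V.powersetCard k)
    (hkb : k < b) (hV : 2 * b ≤ V.card) (hKn : K.Nonempty) :
    K.card + (V.card - k) ≤
      ((V.powersetCard b).filter (fun B => ∃ D ∈ K, D ⊆ B)).card + 1 := by
  set U := (V.powersetCard b).filter (fun B => ∃ D ∈ K, D ⊆ B) with hU
  set F := (V.powersetCard b \ U).image (fun B => V \ B) with hF
  have hFc : F.card = V.card.choose b - U.card := by
    rw [hF, card_image_of_injOn, card_sdiff_of_subset (filter_subset _ _), card_powersetCard]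
    intro A hA B hB hAB
    have h1 := (mem_powersetCard.1 (mem_sdiff.1 hA).1).1
    have h2 := (mem_powersetCard.1 (mem_sdiff.1 hB).1).1
    simp only at hAB
    rw [← Finset.sdiff_sdiff_eq_self h1, hAB, Finset.sdiff_sdiff_eq_self h2]
  have hUc : U.card ≤ V.card.choose b := by
    rw [← card_powersetCard]; exact card_le_card (filter_subset _ _)
  have key := HM1 k (V := V) (F := F) (G := K) (a := V.card - b) (by
    intro A hA
    obtain ⟨B, hB, rfl⟩ := mem_image.1 hA
    have h1 := mem_powersetCard.1 (mem_sdiff.1 hB).1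
    rw [mem_powersetCard, card_sdiff_of_subset h1.1, h1.2]
    exact ⟨sdiff_subset, rfl⟩) hK (by
    intro A hA D hD
    obtain ⟨B, hB, rfl⟩ := mem_image.1 hA
    rw [mem_sdiff] at hB
    by_contra hne
    rw [not_nonempty_iff_eq_empty] at hne
    apply hB.2
    rw [hU, mem_filter]
    refine ⟨hB.1, D, hD, fun x hx => ?_⟩
    by_contra hxB
    have : x ∈ (V \ B) ∩ D := by
      rw [mem_inter, mem_sdiff]
      exact ⟨⟨(mem_powersetCard.1 (hK hD)).1 hx, hxB⟩, hx⟩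
    rw [hne] at this
    simp at this) (by omega) (by omega) hKn
  rw [Nat.choose_symm (by omega)] at key
  have h3 : V.card - k ≤ (V.card - k).choose (V.card - b) := by
    have := choose_le_choose_of' (m := V.card - k) (k := V.card - b) (by omega) (by omega)
    exact this
  omega

lemma step_bound {r : ℕ} (hr : 1 ≤ r) (hP : PP r) {V : Finset ℕ} {F 𝓖 K : Finset (Finset ℕ)}
    {a b k : ℕ} (hb : 2 ≤ b) (hk1 : 1 ≤ k) (hkb : k < b) (hab : b + r ≤ a + 1)
    (hVk : a + k ≤ V.card) (hVr : b * r ≤ V.card) (hF : F ⊆ V.powersetCard a)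
    (h𝓖 : ∀ B ∈ 𝓖, B ⊆ V ∧ B.card ≤ b) (hK : K ⊆ V.powersetCard k) (hK𝓖 : K ⊆ 𝓖)
    (h : CI F 𝓖) (hc : CovGE V r 𝓖) :
    (F.card : ℤ) + K.card ≤ hcL V.card a (List.replicate r b) := by
  rcases Nat.lt_or_ge V.card (a + b) with hlt | hge
  · rw [hcL_small V.card a b r hlt (by nlinarith)]
    exact_mod_cast NM hF hK (fun A hA B hB => h A hA B (hK𝓖 hB)) (by omega) hVk
  rcases F.eq_empty_or_nonempty with rfl | hFn
  · have h1 := hcL_lower V.card a k (List.replicate r b) (by simpa [mul_comm] using hVr)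
      (by intro x hx; have := List.eq_of_mem_replicate hx; omega) (by simp; omega) hVk
    have h2 := card_le_card hK
    rw [card_powersetCard] at h2
    simp
    have h3 : (K.card : ℤ) ≤ (V.card.choose k : ℤ) := by exact_mod_cast h2
    omega
  set G := (V.powersetCard b).filter (fun B => ∃ D ∈ 𝓖, D ⊆ B) with hG
  have hcG : CovGE V r G := by
    intro T hT hcT
    by_contra hlt
    push Not at hlt
    have : ∃ D ∈ 𝓖, ¬ (T ∩ D).Nonempty := by
      by_contra hcon
      push Not at hcon
      have := hc T hT (by
        intro B hB; have := hcon B hB; simpa using this)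
      omega
    obtain ⟨D, hD, hTD⟩ := this
    rw [not_nonempty_iff_eq_empty, inter_comm, ← disjoint_iff_inter_eq_empty] at hTD
    have hD' := h𝓖 D hD
    obtain ⟨B, hDB, hBV, hBc⟩ := exists_subsuperset_card_eq (s := D) (t := V \ T) (n := b)
      (subset_sdiff.2 ⟨hD'.1, hTD⟩) hD'.2 (by rw [card_sdiff_of_subset hT]; omega)
    rw [subset_sdiff] at hBV
    have := hcT B (by
      rw [hG, mem_filter, mem_powersetCard]
      exact ⟨⟨hBV.1, hBc⟩, D, hD, hDB⟩)
    rw [inter_comm, disjoint_iff_inter_eq_empty.1 hBV.2] at this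
    simp at this
  have main := hP V F G a b hb hab hge hVr hF (filter_subset _ _) (by
    intro A hA B hB
    obtain ⟨D, hD, hDB⟩ := (mem_filter.1 hB).2
    exact (h A hA D hD).mono (inter_subset_inter_left hDB)) hFn hcG
  have hGK : K.card + r ≤ G.card := by
    rcases K.eq_empty_or_nonempty with rfl | hKn
    · have := hcG.card_le (filter_subset _ _) (by omega)
      simpa using this
    · have h1 := up_bound hK hkb (by omega) hKn
      have h2 : ((V.powersetCard b).filter (fun B => ∃ D ∈ K, D ⊆ B)).card ≤ G.card := by
        apply card_le_card
        intro B hB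
        rw [mem_filter] at hB
        obtain ⟨h3, D, hD, hDB⟩ := hB
        exact mem_filter.2 ⟨h3, D, hK𝓖 hD, hDB⟩
      omega
  have : (K.card : ℤ) + r ≤ G.card := by exact_mod_cast hGK
  omega

lemma sum_shift (f : ℕ → ℤ) (s : ℕ) :
    ∑ i ∈ Icc 1 (s + 1), f i = f 1 + ∑ i ∈ Icc 1 s, f (i + 1) := by
  induction s with
  | zero => simp
  | succ s ih =>
    rw [sum_Icc_succ_top (by omega), ih, sum_Icc_succ_top (by omega)]; ring

lemma cover_erase {F : Finset (Finset ℕ)} {T : Finset ℕ} {x : ℕ}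
    (hcT : ∀ A ∈ F, (T ∩ A).Nonempty) :
    ∀ A ∈ F.nonMemberSubfamily x, (T.erase x ∩ A).Nonempty := by
  intro A hA
  rw [mem_nonMemberSubfamily] at hA
  obtain ⟨y, hy⟩ := hcT A hA.1
  rw [mem_inter] at hy
  exact ⟨y, mem_inter.2 ⟨mem_erase.2 ⟨fun e => hA.2 (e ▸ hy.2), hy.1⟩, hy.2⟩⟩

/-- erasing a point from all sets keeps the structure -/
lemma trace_props {V : Finset ℕ} {F 𝓖 : Finset (Finset ℕ)} {b r x : ℕ}
    (h𝓖 : ∀ B ∈ 𝓖, B ⊆ V ∧ B.card ≤ b) (h : CI F 𝓖) (hc : CovGE V r 𝓖) :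
    (∀ B ∈ 𝓖.image (fun B => B.erase x), B ⊆ V.erase x ∧ B.card ≤ b) ∧
    CI (F.nonMemberSubfamily x) (𝓖.image (fun B => B.erase x)) ∧
    CovGE (V.erase x) r (𝓖.image (fun B => B.erase x)) ∧
    𝓖.memberSubfamily x ⊆ 𝓖.image (fun B => B.erase x) := by
  refine ⟨?_, ?_, ?_, ?_⟩
  · intro B hB
    obtain ⟨D, hD, rfl⟩ := mem_image.1 hB
    exact ⟨erase_subset_erase x (h𝓖 D hD).1, (card_erase_le).trans (h𝓖 D hD).2⟩
  · intro A hA B hB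
    obtain ⟨D, hD, rfl⟩ := mem_image.1 hB
    rw [mem_nonMemberSubfamily] at hA
    obtain ⟨y, hy⟩ := h A hA.1 D hD
    rw [mem_inter] at hy
    exact ⟨y, mem_inter.2 ⟨hy.1, mem_erase.2 ⟨fun e => hA.2 (e ▸ hy.1), hy.2⟩⟩⟩
  · intro T hT hcT
    refine hc T (hT.trans (erase_subset _ _)) ?_
    intro B hB
    exact (hcT _ (mem_image_of_mem _ hB)).mono (inter_subset_inter_left (erase_subset _ _))
  · intro B hB
    rw [mem_memberSubfamily] at hB
    exact mem_image.2 ⟨_, hB.1, erase_insert hB.2⟩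

lemma stage_bound {r : ℕ} (hr : 1 ≤ r) (hP : PP r) {a b : ℕ} (hb : 2 ≤ b)
    (hab : b + r + 1 ≤ a + 1) (s : ℕ) :
    ∀ {V : Finset ℕ} {F 𝓖 K : Finset (Finset ℕ)} {k : ℕ} {T : Finset ℕ}, s ≤ k → k < b →
    a + k ≤ V.card → b * r + s ≤ V.card → F ⊆ V.powersetCard a →
    (∀ B ∈ 𝓖, B ⊆ V ∧ B.card ≤ b) → K ⊆ V.powersetCard k → K ⊆ 𝓖 →
    CI F 𝓖 → CovGE V (r + 1) 𝓖 → T ⊆ V → (∀ A ∈ F, (T ∩ A).Nonempty) → T.card = s →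
    (F.card : ℤ) + K.card ≤ ∑ i ∈ Icc 1 s, hcL (V.card - i) (a - 1) (List.replicate r b) +
      ((V.card - s).choose (k - s) : ℤ) := by
  induction s with
  | zero =>
    intro V F 𝓖 K k T _ _ _ _ hF _ hK _ _ _ _ hcT hT0
    have hFe : F = ∅ := by
      rw [eq_empty_iff_forall_notMem]
      intro A hA
      have := hcT A hA
      rw [card_eq_zero.1 hT0] at this
      simp at this
    have h2 := card_le_card hK
    rw [card_powersetCard] at h2
    simp [hFe]
    exact_mod_cast h2
  | succ s ih =>
    intro V F 𝓖 K k T hsk hkb hVk hVr hF h𝓖 hK hK𝓖 h hc hTV hcT hTs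
    obtain ⟨x, hx⟩ : T.Nonempty := card_pos.1 (by omega)
    have hxV := hTV hx
    have hVc := card_erase_of_mem hxV
    obtain ⟨p1, p2, p3, p4⟩ := trace_props (x := x) h𝓖 h hc
    have h1 := step_bound hr hP (V := V.erase x) (F := F.memberSubfamily x)
      (𝓖 := 𝓖.nonMemberSubfamily x) (K := K.nonMemberSubfamily x) (a := a - 1) (b := b) (k := k)
      hb (by omega) hkb (by omega) (by omega) (by omega) (link_sub x hF)
      (by
        intro B hB
        rw [mem_nonMemberSubfamily] at hB
        exact ⟨subset_erase.2 ⟨(h𝓖 B hB.1).1, hB.2⟩, (h𝓖 B hB.1).2⟩)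
      (del_sub_s2 x hK)
      (by
        intro B hB
        rw [mem_nonMemberSubfamily] at hB ⊢
        exact ⟨hK𝓖 hB.1, hB.2⟩)
      (h.link_del x) (hc.del hxV)
    have h2 := ih (V := V.erase x) (F := F.nonMemberSubfamily x)
      (𝓖 := 𝓖.image (fun B => B.erase x)) (K := K.memberSubfamily x) (k := k - 1)
      (T := T.erase x) (by omega) (by omega) (by omega) (by omega) (del_sub_s2 x hF) p1
      (link_sub x hK)
      (by
        refine Subset.trans ?_ p4
        intro B hB
        rw [mem_memberSubfamily] at hB ⊢
        exact ⟨hK𝓖 hB.1, hB.2⟩)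
      p2 p3 (erase_subset_erase x hTV) (cover_erase hcT)
      (by rw [card_erase_of_mem hx]; omega)
    have e1 := card_memberSubfamily_add_card_nonMemberSubfamily x F
    have e2 := card_memberSubfamily_add_card_nonMemberSubfamily x K
    rw [hVc] at h1 h2
    rw [sum_shift]
    have e3 : ∑ i ∈ Icc 1 s, hcL (V.card - (i + 1)) (a - 1) (List.replicate r b) =
        ∑ i ∈ Icc 1 s, hcL (V.card - 1 - i) (a - 1) (List.replicate r b) := by
      apply sum_congr rfl
      intro i _
      rw [Nat.sub_sub, add_comm 1 i]
    rw [e3, show V.card - (s + 1) = V.card - 1 - s by omega,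
      show k - (s + 1) = k - 1 - s by omega]
    omega

lemma core_bound {r : ℕ} (hr : 1 ≤ r) (hP : PP r) {a b s : ℕ} (hb : 2 ≤ b)
    (hab : b + (r + 1) ≤ a + 1) {V : Finset ℕ} {F G : Finset (Finset ℕ)} {T : Finset ℕ}
    (hsb : s ≤ b) (hVab : a + b ≤ V.card) (hVr : b * (r + 1) ≤ V.card)
    (hF : F ⊆ V.powersetCard a) (hG : G ⊆ V.powersetCard b) (h : CI F G) (hFn : F.Nonempty)
    (hc : CovGE V (r + 1) G) (hTV : T ⊆ V) (hcT : ∀ A ∈ F, (T ∩ A).Nonempty) (hTs : T.card = s) :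
    (F.card : ℤ) + G.card ≤ ∑ i ∈ Icc 1 s, hcL (V.card - i) (a - 1) (List.replicate r b) +
      ((V.card - s).choose (b - s) : ℤ) + r := by
  obtain ⟨A0, hA0⟩ := hFn
  obtain ⟨x, hx⟩ := hcT A0 hA0
  rw [mem_inter] at hx
  have hxV := hTV hx.1
  have hVc := card_erase_of_mem hxV
  have hVr' : b * r + b ≤ V.card := by rw [Nat.mul_succ] at hVr; exact hVr
  obtain ⟨s, rfl⟩ : ∃ s', s = s' + 1 := ⟨s - 1, by have := card_pos.2 ⟨x, hx.1⟩; omega⟩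
  have h𝓖 : ∀ B ∈ G, B ⊆ V ∧ B.card ≤ b := fun B hB =>
    ⟨(mem_powersetCard.1 (hG hB)).1, (mem_powersetCard.1 (hG hB)).2.le⟩
  obtain ⟨p1, p2, p3, p4⟩ := trace_props (x := x) h𝓖 h hc
  have h1 := hP (V.erase x) (F.memberSubfamily x) (G.nonMemberSubfamily x) (a - 1) b hb
    (by omega) (by omega) (by omega) (link_sub x hF) (del_sub_s2 x hG) (h.link_del x)
    ⟨A0.erase x, by rw [mem_memberSubfamily, insert_erase hx.2]; simp [hA0]⟩ (hc.del hxV)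
  have h2 := stage_bound hr hP hb (by omega) s (V := V.erase x) (F := F.nonMemberSubfamily x)
    (𝓖 := G.image (fun B => B.erase x)) (K := G.memberSubfamily x) (k := b - 1)
    (T := T.erase x) (by omega) (by omega) (by omega) (by omega) (del_sub_s2 x hF) p1
    (link_sub x hG) p4 p2 p3 (erase_subset_erase x hTV) (cover_erase hcT)
    (by rw [card_erase_of_mem hx.1]; omega)
  have e1 := card_memberSubfamily_add_card_nonMemberSubfamily x F
  have e2 := card_memberSubfamily_add_card_nonMemberSubfamily x G
  rw [hVc] at h1 h2
  rw [sum_shift]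
  have e3 : ∑ i ∈ Icc 1 s, hcL (V.card - (i + 1)) (a - 1) (List.replicate r b) =
      ∑ i ∈ Icc 1 s, hcL (V.card - 1 - i) (a - 1) (List.replicate r b) := by
    apply sum_congr rfl
    intro i _
    rw [Nat.sub_sub, add_comm 1 i]
  rw [e3, show V.card - (s + 1) = V.card - 1 - s by omega,
    show b - (s + 1) = b - 1 - s by omega]
  omega

lemma PP_all (r : ℕ) (hr : 1 ≤ r) : PP r := by
  induction r, hr using Nat.le_induction with
  | base => exact PP_one
  | succ r hr ih =>
    intro V F G a b hb hab hV hVr hF hG h hFn hc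
    obtain ⟨B, hB⟩ : G.Nonempty := card_pos.1 (by have := hc.card_le hG (by omega); omega)
    have hB' := mem_powersetCard.1 (hG hB)
    have key := core_bound hr ih hb hab le_rfl hV hVr hF hG h hFn hc hB'.1
      (fun A hA => by rw [inter_comm]; exact h A hA B hB) hB'.2
    rw [hcL_telescope _ _ _ _ (by simp; rw [mul_comm r b]; rw [Nat.mul_succ] at hVr; omega)] at key
    rw [List.replicate_succ]
    rw [show a - 1 + 1 = a by omega] at key
    simp at key
    push_cast
    omega

theorem stmt2 (n a b s t : ℕ) (hn : 1 ≤ n) (ha : 1 ≤ a) (hb : 2 ≤ b) (hs : 1 ≤ s)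
    (ht : 2 ≤ t) (habt : b + t ≤ a + 1) (hnab : a + b ≤ n) (hnbt : b * t ≤ n)
    (F G : Finset (Finset ℕ))
    (hF : F ⊆ (Finset.Icc 1 n).powersetCard a)
    (hG : G ⊆ (Finset.Icc 1 n).powersetCard b)
    (hcross : crossInt F G)
    (hFcov : coverEQ n s F)
    (hGcov : coverGE n t G) :
    (F.card : ℤ) + G.card ≤ MstSize n a b s t := by
  obtain ⟨hFge, T, hTV, hcT, hTs⟩ := hFcov
  obtain ⟨r, rfl⟩ : ∃ r, t = r + 1 := ⟨t - 1, by omega⟩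
  have hV : (Finset.Icc 1 n).card = n := by simp
  have hGpos : r + 1 ≤ G.card := CovGE.card_le (V := Finset.Icc 1 n) hGcov hG (by omega)
  obtain ⟨B, hB⟩ : G.Nonempty := card_pos.1 (by omega)
  have hB' := mem_powersetCard.1 (hG hB)
  have hsb : s ≤ b := by
    rw [← hB'.2]
    exact hFge B hB'.1 (fun A hA => by rw [inter_comm]; exact hcross A hA B hB)
  have hFn : F.Nonempty := by
    rw [nonempty_iff_ne_empty]
    rintro rfl
    have := hFge ∅ (by simp) (by simp)
    simp at this
    omega
  have key := core_bound (r := r) (by omega) (PP_all r (by omega)) hb habt hsb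
    (V := Finset.Icc 1 n) (by rw [hV]; exact hnab) (by rw [hV]; exact hnbt) hF hG hcross hFn
    hGcov hTV hcT hTs
  rw [hV] at key
  rw [Mst_eq]
  simp only [Nat.add_sub_cancel]
  push_cast
  omega
end

section
/- Let a, b, t be integers with t ≥ 2, b ≥ 2 and t ≤ a ≤ b + t - 2. Then there exists n_0 (depending on a, b, t) such that for all n ≥ n_0 the following holds: if F ⊆ C([n],a) and G ⊆ C([n],b) are cross-intersecting families with F nonempty (τ(F) ≥ 1) and τ(G) ≥ t, then |F| + |G| ≤ C(n,b) - C(n-a, b) + 1. -/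
open Finset

lemma cover_count (n a b t : ℕ) (hta : t ≤ a) (F G : Finset (Finset ℕ))
    (hF : F ⊆ (Finset.Icc 1 n).powersetCard a) (hG : G ⊆ (Finset.Icc 1 n).powersetCard b)
    (hc : crossInt F G) (hcov : coverGE n t G) (k : ℕ) :
    ∀ S : Finset ℕ, S ⊆ Finset.Icc 1 n → S.card + k = t →
      (F.filter (fun A => S ⊆ A)).card ≤ b ^ k * n ^ (a - t) := by
  induction k with
  | zero =>
    intro S hS hk
    have h1 : (F.filter (fun A => S ⊆ A)).card ≤ ((Finset.Icc 1 n).powersetCard (a - t)).card := by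
      apply Finset.card_le_card_of_injOn (fun A => A \ S)
      · intro A hA
        have hA := Finset.mem_filter.1 (Finset.mem_coe.1 hA)
        have h2 := Finset.mem_powersetCard.1 (hF hA.1)
        refine Finset.mem_coe.2 (Finset.mem_powersetCard.2 ⟨Finset.sdiff_subset.trans h2.1, ?_⟩)
        rw [Finset.card_sdiff_of_subset hA.2, h2.2]
        omega
      · intro A hA B hB hAB
        have hA := Finset.mem_filter.1 (Finset.mem_coe.1 hA)
        have hB := Finset.mem_filter.1 (Finset.mem_coe.1 hB)
        have hAB : A \ S = B \ S := hAB
        rw [← Finset.sdiff_union_of_subset hA.2, hAB, Finset.sdiff_union_of_subset hB.2]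
    rw [Finset.card_powersetCard, Nat.card_Icc] at h1
    have h3 := Nat.choose_le_pow (n := n) (k := a - t)
    simpa using h1.trans h3
  | succ k ih =>
    intro S hS hk
    have hnot : ¬ ∀ A ∈ G, (S ∩ A).Nonempty := by
      intro h
      have := hcov S hS h
      omega
    push Not at hnot
    obtain ⟨B, hB, hSB⟩ := hnot
    have hB' := Finset.mem_powersetCard.1 (hG hB)
    have hsub : F.filter (fun A => S ⊆ A) ⊆
        B.biUnion (fun x => F.filter (fun A => insert x S ⊆ A)) := by
      intro A hA
      obtain ⟨hA, hSA⟩ := Finset.mem_filter.1 hA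
      obtain ⟨x, hx⟩ := hc A hA B hB
      obtain ⟨hxA, hxB⟩ := Finset.mem_inter.1 hx
      exact Finset.mem_biUnion.2 ⟨x, hxB, Finset.mem_filter.2
        ⟨hA, Finset.insert_subset hxA hSA⟩⟩
    refine (Finset.card_le_card hsub).trans ?_
    refine (Finset.card_biUnion_le_card_mul _ _ (b ^ k * n ^ (a - t)) ?_).trans ?_
    · intro x hx
      have hxS : x ∉ S := by
        intro h
        have : x ∈ S ∩ B := Finset.mem_inter.2 ⟨h, hx⟩
        rw [hSB] at this
        simp at this
      apply ih
      · exact Finset.insert_subset (hB'.1 hx) hS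
      · rw [Finset.card_insert_of_notMem hxS]
        omega
    · rw [hB'.2, pow_succ]
      apply le_of_eq
      ring

lemma asymp (a b t n : ℕ) (hb : 2 ≤ b) (hab : a ≤ b + t - 2) (hta : t ≤ a)
    (h1 : 2 * (a + b) ≤ n) (h2 : b ^ t * (2 ^ (b - 1) * (b - 1).factorial) ≤ n) :
    b ^ t * n ^ (a - t) ≤ (n - a - 1).choose (b - 1) := by
  have h3 : n ^ (a - t) ≤ n ^ (b - 2) := Nat.pow_le_pow_right (by omega) (by omega)
  have h4 : (n - a - 1 + 1 - (b - 1)) ^ (b - 1) ≤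
      (b - 1).factorial * (n - a - 1).choose (b - 1) := by
    have := Nat.pow_sub_le_descFactorial (n - a - 1) (b - 1)
    rwa [Nat.descFactorial_eq_factorial_mul_choose] at this
  have h5 : n ^ (b - 1) ≤ (2 * (n - a - 1 + 1 - (b - 1))) ^ (b - 1) :=
    Nat.pow_le_pow_left (by omega) _
  rw [mul_pow] at h5
  have hpos : 0 < 2 ^ (b - 1) * (b - 1).factorial := by positivity
  refine Nat.le_of_mul_le_mul_left ?_ hpos
  calc 2 ^ (b - 1) * (b - 1).factorial * (b ^ t * n ^ (a - t))
      ≤ 2 ^ (b - 1) * (b - 1).factorial * (b ^ t * n ^ (b - 2)) := by gcongr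
    _ = b ^ t * (2 ^ (b - 1) * (b - 1).factorial) * n ^ (b - 2) := by ring
    _ ≤ n * n ^ (b - 2) := by gcongr
    _ = n ^ (b - 1) := by
      rw [← pow_succ']
      congr 1
      omega
    _ ≤ 2 ^ (b - 1) * (n - a - 1 + 1 - (b - 1)) ^ (b - 1) := h5
    _ ≤ 2 ^ (b - 1) * ((b - 1).factorial * (n - a - 1).choose (b - 1)) := by gcongr
    _ = _ := by ring

theorem stmt5 (a b t : ℕ) (ht : 2 ≤ t) (hb : 2 ≤ b) (hta : t ≤ a)
    (hab : a ≤ b + t - 2) :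
    ∃ n₀ : ℕ, ∀ n : ℕ, n₀ ≤ n →
      ∀ F G : Finset (Finset ℕ),
        F ⊆ (Finset.Icc 1 n).powersetCard a →
        G ⊆ (Finset.Icc 1 n).powersetCard b →
        crossInt F G →
        F.Nonempty →
        coverGE n t G →
        (F.card : ℤ) + G.card ≤ (n.choose b : ℤ) - ((n - a).choose b : ℤ) + 1 := by
  refine ⟨2 * (a + b) + b ^ t * (2 ^ (b - 1) * (b - 1).factorial), ?_⟩
  intro n hn F G hF hG hc hne hcov
  have hasy := asymp a b t n hb hab hta (by omega) (by omega)
  have hcount := cover_count n a b t hta F G hF hG hc hcov t ∅ (by simp) (by simp)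
  simp only [Finset.empty_subset, Finset.filter_true] at hcount
  have hcardP : ((Finset.Icc 1 n).powersetCard b).card = n.choose b := by simp
  have hY : ∀ A ∈ F, ((Finset.Icc 1 n \ A).powersetCard b).card = (n - a).choose b := by
    intro A hA
    have h2 := Finset.mem_powersetCard.1 (hF hA)
    rw [Finset.card_powersetCard, Finset.card_sdiff_of_subset h2.1, h2.2]
    simp
  have hGY : ∀ A ∈ F, Disjoint G ((Finset.Icc 1 n \ A).powersetCard b) := by
    intro A hA
    rw [Finset.disjoint_left]
    intro B hB hB'
    obtain ⟨x, hx⟩ := hc A hA B hB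
    obtain ⟨hxA, hxB⟩ := Finset.mem_inter.1 hx
    have := (Finset.mem_powersetCard.1 hB').1 hxB
    exact (Finset.mem_sdiff.1 this).2 hxA
  have hYP : ∀ A : Finset ℕ, (Finset.Icc 1 n \ A).powersetCard b ⊆
      (Finset.Icc 1 n).powersetCard b :=
    fun A => Finset.powersetCard_mono Finset.sdiff_subset
  by_cases hF1 : F.card ≤ 1
  · obtain ⟨A, hA⟩ := hne
    have h1 := Finset.card_le_card (Finset.union_subset hG (hYP A))
    rw [Finset.card_union_of_disjoint (hGY A hA), hY A hA, hcardP] at h1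
    omega
  · obtain ⟨A, hA, A', hA', hAA'⟩ := Finset.one_lt_card.1 (not_le.1 hF1)
    have h2 := Finset.mem_powersetCard.1 (hF hA)
    have h2' := Finset.mem_powersetCard.1 (hF hA')
    have hns : ¬ A ⊆ A' := by
      intro h
      exact hAA' (Finset.eq_of_subset_of_card_le h (by omega))
    obtain ⟨x, hxA, hxA'⟩ := Finset.not_subset.1 hns
    have hxI : x ∈ Finset.Icc 1 n \ A' := Finset.mem_sdiff.2 ⟨h2.1 hxA, hxA'⟩
    set X := (((Finset.Icc 1 n \ A').erase x).powersetCard (b - 1)).image (insert x) with hX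
    have hXcard : X.card = (n - a - 1).choose (b - 1) := by
      rw [hX, Finset.card_image_of_injOn, Finset.card_powersetCard, Finset.card_erase_of_mem hxI,
        Finset.card_sdiff_of_subset h2'.1, h2'.2]
      · simp
      · intro B hB C hC hBC
        have hB := Finset.mem_powersetCard.1 (Finset.mem_coe.1 hB)
        have hC := Finset.mem_powersetCard.1 (Finset.mem_coe.1 hC)
        have hxB : x ∉ B := fun h => Finset.notMem_erase x _ (hB.1 h)
        have hxC : x ∉ C := fun h => Finset.notMem_erase x _ (hC.1 h)
        have hBC : insert x B = insert x C := hBC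
        rw [← Finset.erase_insert hxB, hBC, Finset.erase_insert hxC]
    have hXY : X ⊆ (Finset.Icc 1 n \ A').powersetCard b := by
      intro B hB
      obtain ⟨C, hC, rfl⟩ := Finset.mem_image.1 hB
      have hC := Finset.mem_powersetCard.1 hC
      have hxC : x ∉ C := fun h => Finset.notMem_erase x _ (hC.1 h)
      refine Finset.mem_powersetCard.2
        ⟨Finset.insert_subset hxI (hC.1.trans (Finset.erase_subset _ _)), ?_⟩
      rw [Finset.card_insert_of_notMem hxC, hC.2]
      omega
    have hGX : Disjoint G X := Finset.disjoint_of_subset_right hXY (hGY A' hA')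
    have hYX : Disjoint ((Finset.Icc 1 n \ A).powersetCard b) X := by
      rw [Finset.disjoint_left]
      intro B hB hB'
      obtain ⟨C, hC, rfl⟩ := Finset.mem_image.1 hB'
      have := (Finset.mem_powersetCard.1 hB).1 (Finset.mem_insert_self x C)
      exact (Finset.mem_sdiff.1 this).2 hxA
    have h1 := Finset.card_le_card (Finset.union_subset (Finset.union_subset hG (hYP A))
      (hXY.trans (hYP A')))
    rw [Finset.card_union_of_disjoint (Finset.disjoint_union_left.2 ⟨hGX, hYX⟩),
      Finset.card_union_of_disjoint (hGY A hA), hY A hA, hcardP, hXcard] at h1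
    omega
end

section
/- Let n, a, b, s, t be integers with a ≥ b + t - 1, b ≥ 2, s ≥ 2, t ≥ 2 and n ≥ a + b. Suppose F ⊆ C([n],a) and G ⊆ C([n],b) are initial (left-shifted) cross-intersecting families with τ(F) ≥ s and τ(G) ≥ t. Then |F| + |G| ≤ C(n,a) - Σ_{i=0}^{t-1} C(b+t-1, i) · C(n-b-t+1, a-i) + C(b+t-1, b). -/
open Finset

/-- The `a`-subsets of `[n]` meeting `[m]` in at least `t` elements. -/
def Hfam (n a m t : ℕ) : Finset (Finset ℕ) :=
  ((Icc 1 n).powersetCard a).filter (fun A => t ≤ (A ∩ Icc 1 m).card)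

theorem mem_Hfam {n a m t : ℕ} {A : Finset ℕ} :
    A ∈ Hfam n a m t ↔ (A ⊆ Icc 1 n ∧ A.card = a) ∧ t ≤ (A ∩ Icc 1 m).card := by
  simp [Hfam, mem_powersetCard]

theorem subset_Icc_pred {n : ℕ} {A : Finset ℕ} (h : A ⊆ Icc 1 (n + 1)) (hn : n + 1 ∉ A) :
    A ⊆ Icc 1 n := by
  intro x hx
  have h1 := mem_Icc.1 (h hx)
  have : x ≠ n + 1 := fun e => hn (e ▸ hx)
  exact mem_Icc.2 ⟨h1.1, by omega⟩

theorem not_mem_of_subset {n : ℕ} {A : Finset ℕ} (h : A ⊆ Icc 1 n) : n + 1 ∉ A := by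
  intro hx
  have := mem_Icc.1 (h hx)
  omega

theorem insert_inter_Icc {n m : ℕ} (hm : m ≤ n) (A : Finset ℕ) :
    insert (n + 1) A ∩ Icc 1 m = A ∩ Icc 1 m := by
  apply Finset.insert_inter_of_notMem
  simp; omega

theorem core (N : ℕ) : ∀ (n a b m t : ℕ) (X Y : Finset (Finset ℕ)), n + m = N → m ≤ n →
    a + b ≤ n → X ⊆ Hfam n a m t → Y ⊆ (Icc 1 n).powersetCard b →
    (∀ B ∈ Y, (B ∩ Icc 1 m).card + t ≤ m) → crossInt X Y → initialFam n X →
    (t + b ≤ a ∨ (1 ≤ t ∧ t + b ≤ a + 1 ∧ ∀ B ∈ Y, 2 ≤ (B ∩ Icc 1 (m + 1)).card)) →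
    X.card + Y.card ≤ (Hfam n a m t).card := by
  induction N using Nat.strong_induction_on with
  | _ N ih =>
  intro n a b m t X Y hN hmn hab hX hY hYm hc hi hcase
  by_cases hYe : Y = ∅
  · subst hYe
    simpa using card_le_card hX
  obtain ⟨B0, hB0⟩ := Finset.nonempty_iff_ne_empty.2 hYe
  have hB0m := hYm B0 hB0
  have hB0c : B0.card = b := (mem_powersetCard.1 (hY hB0)).2
  have hb2 : t + b ≤ a ∨ 2 ≤ b := by
    rcases hcase with h | ⟨h1, h2, h3⟩
    · exact Or.inl h
    · right
      have := h3 B0 hB0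
      have := card_le_card (inter_subset_left : B0 ∩ Icc 1 (m+1) ⊆ B0)
      omega
  have hba : b ≤ a := by rcases hcase with h | ⟨h1, h2, h3⟩ <;> omega
  have hta : t ≤ a := by rcases hcase with h | ⟨h1, h2, h3⟩ <;> omega
  -- complement case
  rcases Nat.eq_or_lt_of_le hab with hab | hab
  · have key : Y.card ≤ (Hfam n a m t \ X).card := by
      apply Finset.card_le_card_of_injOn (fun B => Icc 1 n \ B)
      · intro B hB
        have hBn := mem_powersetCard.1 (hY hB)
        have hcm := hYm B hB
        simp only [coe_sdiff, Set.mem_sdiff, mem_coe, mem_Hfam]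
        refine ⟨⟨⟨sdiff_subset, ?_⟩, ?_⟩, ?_⟩
        · rw [card_sdiff_of_subset hBn.1, hBn.2]; simp; omega
        · have e : (Icc 1 n \ B) ∩ Icc 1 m = Icc 1 m \ (B ∩ Icc 1 m) := by
            ext x; simp only [mem_inter, mem_sdiff, mem_Icc]
            constructor
            · rintro ⟨⟨h1, h2⟩, h3⟩; exact ⟨h3, fun h => h2 h.1⟩
            · rintro ⟨h1, h2⟩; exact ⟨⟨⟨h1.1, by omega⟩, fun h => h2 ⟨h, h1⟩⟩, h1⟩
          rw [e, card_sdiff_of_subset inter_subset_right]; simp; omega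
        · intro h
          obtain ⟨x, hx⟩ := hc _ h B hB
          simp at hx
      · intro B hB C hC h
        have h1 := (mem_powersetCard.1 (hY hB)).1
        have h2 := (mem_powersetCard.1 (hY hC)).1
        have h' : Icc 1 n \ B = Icc 1 n \ C := h
        rw [← Finset.sdiff_sdiff_eq_self h1, h', Finset.sdiff_sdiff_eq_self h2]
    rw [card_sdiff_of_subset hX] at key
    have := card_le_card hX
    omega
  -- everything case
  by_cases hall : 0 < m ∧ (n = m ∨ (n = m + 1 ∧ t + 1 ≤ a))
  · have e : Hfam n a m t = Hfam n a 0 0 := by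
      ext A
      simp only [mem_Hfam]
      constructor
      · rintro ⟨h, -⟩; exact ⟨h, by simp⟩
      · rintro ⟨h, -⟩
        refine ⟨h, ?_⟩
        rcases hall.2 with hh | ⟨hh, hh2⟩
        · subst hh; rw [inter_eq_left.2 h.1]; omega
        · have : A.erase n ⊆ A ∩ Icc 1 m := by
            intro x hx
            have h1 := mem_erase.1 hx
            have h2 := mem_Icc.1 (h.1 h1.2)
            exact mem_inter.2 ⟨h1.2, mem_Icc.2 ⟨h2.1, by omega⟩⟩
          have h3 := card_le_card this
          have := Finset.pred_card_le_card_erase (s := A) (a := n)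
          omega
    rw [e] at hX ⊢
    exact ih (n + 0) (by omega) n a b 0 0 X Y rfl (by omega) hab.le hX hY (by simp) hc hi
      (Or.inl (by omega))
  have hmn' : m + 1 ≤ n := by
    by_contra h
    apply hall
    omega
  -- b = 0
  rcases Nat.eq_zero_or_pos b with hb0 | hb0
  · subst hb0
    have hXe : X = ∅ := by
      rw [Finset.eq_empty_iff_forall_notMem]
      intro A hA
      obtain ⟨x, hx⟩ := hc A hA B0 hB0
      rw [card_eq_zero.1 hB0c] at hx
      simp at hx
    have hY1 : Y.card ≤ 1 := by
      have := card_le_card hY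
      simpa using this
    have : 0 < (Hfam n a m t).card := by
      rw [card_pos]
      refine ⟨Icc 1 a, mem_Hfam.2 ⟨⟨Icc_subset_Icc le_rfl (by omega), by simp⟩, ?_⟩⟩
      have : Icc 1 t ⊆ Icc 1 a ∩ Icc 1 m :=
        subset_inter (Icc_subset_Icc le_rfl (by omega)) (Icc_subset_Icc le_rfl (by omega))
      simpa using card_le_card this
    rw [hXe]; simp; omega
  -- recursion
  obtain ⟨n, rfl⟩ : ∃ k, n = k + 1 := ⟨n - 1, by omega⟩
  obtain ⟨b, rfl⟩ : ∃ k, b = k + 1 := ⟨b - 1, by omega⟩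
  obtain ⟨a, rfl⟩ : ∃ k, a = k + 1 := ⟨a - 1, by omega⟩
  have hmn2 : (t + (b+1) ≤ a+1) ∨ m + 1 ≤ n := by
    by_contra h
    push Not at h
    have h2 : 2 ≤ b + 1 := by omega
    apply hall
    rcases hcase with h' | ⟨h1, h2, h3⟩ <;> omega
  have r1 := ih (n + m) (by omega) n (a+1) (b+1) m t (X.nonMemberSubfamily (n+1))
    (Y.nonMemberSubfamily (n+1)) rfl (by omega) (by omega) ?_ ?_ ?_ ?_ ?_ ?_
  have r2 := ih (n + m) (by omega) n a b m t (X.memberSubfamily (n+1))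
    (Y.memberSubfamily (n+1)) rfl (by omega) (by omega) ?_ ?_ ?_ ?_ ?_ ?_
  · have e1 := card_memberSubfamily_add_card_nonMemberSubfamily (n+1) X
    have e2 := card_memberSubfamily_add_card_nonMemberSubfamily (n+1) Y
    have e3 := card_memberSubfamily_add_card_nonMemberSubfamily (n+1) (Hfam (n+1) (a+1) m t)
    have e4 : Hfam n (a+1) m t ⊆ (Hfam (n+1) (a+1) m t).nonMemberSubfamily (n+1) := by
      intro A hA
      rw [mem_Hfam] at hA
      rw [mem_nonMemberSubfamily, mem_Hfam]
      exact ⟨⟨⟨hA.1.1.trans (Icc_subset_Icc le_rfl (by omega)), hA.1.2⟩, hA.2⟩,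
        not_mem_of_subset hA.1.1⟩
    have e5 : Hfam n a m t ⊆ (Hfam (n+1) (a+1) m t).memberSubfamily (n+1) := by
      intro A hA
      rw [mem_Hfam] at hA
      have hn := not_mem_of_subset hA.1.1
      rw [mem_memberSubfamily, mem_Hfam, insert_inter_Icc (by omega), card_insert_of_notMem hn]
      refine ⟨⟨⟨?_, by omega⟩, hA.2⟩, hn⟩
      apply insert_subset (by simp)
      exact hA.1.1.trans (Icc_subset_Icc le_rfl (by omega))
    have := card_le_card e4
    have := card_le_card e5
    omega
  · intro A hA
    rw [mem_memberSubfamily] at hA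
    have h := mem_Hfam.1 (hX hA.1)
    rw [insert_inter_Icc (by omega), card_insert_of_notMem hA.2] at h
    exact mem_Hfam.2 ⟨⟨subset_Icc_pred ((subset_insert _ _).trans h.1.1) hA.2, by omega⟩, h.2⟩
  · intro A hA
    rw [mem_memberSubfamily] at hA
    have h := mem_powersetCard.1 (hY hA.1)
    rw [card_insert_of_notMem hA.2] at h
    exact mem_powersetCard.2 ⟨subset_Icc_pred ((subset_insert _ _).trans h.1) hA.2, by omega⟩
  · intro A hA
    rw [mem_memberSubfamily] at hA
    have h := hYm _ hA.1
    rwa [insert_inter_Icc (by omega)] at h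
  · intro A hA B hB
    rw [mem_memberSubfamily] at hA hB
    by_contra hne
    rw [not_nonempty_iff_eq_empty] at hne
    have hA1 := mem_Hfam.1 (hX hA.1)
    have hB1 := mem_powersetCard.1 (hY hB.1)
    rw [card_insert_of_notMem hA.2] at hA1
    rw [card_insert_of_notMem hB.2] at hB1
    have hlt : (A ∪ B).card < (Icc 1 n).card := by
      have := card_union_le A B
      simp; omega
    obtain ⟨i, hi1, hi2⟩ := exists_mem_notMem_of_card_lt_card hlt
    rw [mem_union, not_or] at hi2
    have hi3 := mem_Icc.1 hi1
    have hs := hi _ hA.1 i (mem_Icc.2 ⟨hi3.1, by omega⟩) (n+1) (mem_insert_self _ _) (by omega)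
      (by rw [mem_insert, not_or]; exact ⟨by omega, hi2.1⟩)
    rw [erase_insert hA.2] at hs
    obtain ⟨x, hx⟩ := hc _ hs _ hB.1
    simp only [mem_inter, mem_insert] at hx
    rcases hx with ⟨h1 | h1, h2 | h2⟩
    · omega
    · exact hi2.2 (h1 ▸ h2)
    · exact hA.2 (h2 ▸ h1)
    · have : x ∈ A ∩ B := mem_inter.2 ⟨h1, h2⟩
      rw [hne] at this; simp at this
  · intro A hA i hi' j hj hij hiA
    rw [mem_memberSubfamily] at hA ⊢
    have hi3 := mem_Icc.1 hi'
    have hjn : j ≠ n + 1 := fun e => hA.2 (e ▸ hj)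
    have hs := hi _ hA.1 i (mem_Icc.2 ⟨hi3.1, by omega⟩) j (mem_insert_of_mem hj) hij
      (by rw [mem_insert, not_or]; exact ⟨by omega, hiA⟩)
    rw [erase_insert_of_ne (Ne.symm hjn), Finset.insert_comm] at hs
    refine ⟨hs, ?_⟩
    simp only [mem_insert, mem_erase, not_or, not_and]
    exact ⟨by omega, fun _ => hA.2⟩
  · rcases hmn2 with h | h
    · left; omega
    rcases hcase with h' | ⟨h1, h2, h3⟩
    · left; omega
    · right
      refine ⟨h1, by omega, ?_⟩
      intro B hB
      rw [mem_memberSubfamily] at hB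
      have := h3 _ hB.1
      rwa [insert_inter_Icc h] at this
  · intro A hA
    rw [mem_nonMemberSubfamily] at hA
    have h := mem_Hfam.1 (hX hA.1)
    exact mem_Hfam.2 ⟨⟨subset_Icc_pred h.1.1 hA.2, h.1.2⟩, h.2⟩
  · intro A hA
    rw [mem_nonMemberSubfamily] at hA
    have h := mem_powersetCard.1 (hY hA.1)
    exact mem_powersetCard.2 ⟨subset_Icc_pred h.1 hA.2, h.2⟩
  · intro A hA
    rw [mem_nonMemberSubfamily] at hA
    exact hYm _ hA.1
  · intro A hA B hB
    rw [mem_nonMemberSubfamily] at hA hB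
    exact hc _ hA.1 _ hB.1
  · intro A hA i hi' j hj hij hiA
    rw [mem_nonMemberSubfamily] at hA ⊢
    have hi3 := mem_Icc.1 hi'
    refine ⟨hi _ hA.1 i (mem_Icc.2 ⟨hi3.1, by omega⟩) j hj hij hiA, ?_⟩
    simp only [mem_insert, mem_erase, not_or, not_and]
    exact ⟨by omega, fun _ => hA.2⟩
  · rcases hcase with h' | ⟨h1, h2, h3⟩
    · left; omega
    · right
      refine ⟨h1, by omega, ?_⟩
      intro B hB
      rw [mem_nonMemberSubfamily] at hB
      exact h3 _ hB.1

/-- An initial family is closed under going down in the shifting order. -/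
theorem shift_down (n : ℕ) (G : Finset (Finset ℕ)) (hG : initialFam n G) (C : Finset ℕ)
    (hC : C ⊆ Icc 1 n) (d : ℕ) : ∀ B ∈ G, (B \ C).card = d → B.card = C.card →
    (∀ k, (B ∩ Icc 1 k).card ≤ (C ∩ Icc 1 k).card) → B ⊆ Icc 1 n → C ∈ G := by
  induction d with
  | zero =>
    intro B hB h0 hcard _ _
    have : B ⊆ C := by rw [card_eq_zero, sdiff_eq_empty_iff_subset] at h0; exact h0
    rwa [← eq_of_subset_of_card_le this hcard.ge]
  | succ d ih =>
    intro B hB hd hcard hdom hBn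
    have hBC : (B \ C).Nonempty := by rw [← card_pos]; omega
    have hCB : (C \ B).Nonempty := by
      rw [← card_pos]
      have := card_sdiff_add_card_inter B C
      have := card_sdiff_add_card_inter C B
      rw [inter_comm] at this
      omega
    obtain ⟨j, hj, hjmin⟩ := exists_min_image _ id hBC
    obtain ⟨i, hi, himin⟩ := exists_min_image _ id hCB
    simp only [id] at hjmin himin
    rw [mem_sdiff] at hi hj
    have hi1 := mem_Icc.1 (hC hi.1)
    have hj1 := mem_Icc.1 (hBn hj.1)
    have hij : i < j := by
      by_contra hlt
      have hne : i ≠ j := fun e => hj.2 (e ▸ hi.1)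
      have hss : C ∩ Icc 1 j ⊂ B ∩ Icc 1 j := by
        rw [ssubset_iff_of_subset]
        · exact ⟨j, mem_inter.2 ⟨hj.1, mem_Icc.2 ⟨hj1.1, le_rfl⟩⟩,
            fun h => hj.2 (mem_inter.1 h).1⟩
        · intro x hx
          rw [mem_inter, mem_Icc] at hx ⊢
          refine ⟨?_, hx.2⟩
          by_contra hxB
          have := himin x (mem_sdiff.2 ⟨hx.1, hxB⟩)
          omega
      have := card_lt_card hss
      have := hdom j
      omega
    have hnew := hG B hB i (hC hi.1) j hj.1 hij hi.2
    have hie : i ∉ B.erase j := fun h => hi.2 (mem_of_mem_erase h)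
    refine ih _ hnew ?_ ?_ ?_ ?_
    · have : insert i (B.erase j) \ C = (B \ C).erase j := by
        ext x
        simp only [mem_sdiff, mem_insert, mem_erase]
        constructor
        · rintro ⟨rfl | h, h2⟩
          · exact absurd hi.1 h2
          · exact ⟨h.1, h.2, h2⟩
        · rintro ⟨h1, h2, h3⟩
          exact ⟨Or.inr ⟨h1, h2⟩, h3⟩
      rw [this, card_erase_of_mem (mem_sdiff.2 hj)]; omega
    · rw [card_insert_of_notMem hie, card_erase_of_mem hj.1]
      have : 0 < B.card := card_pos.2 ⟨j, hj.1⟩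
      omega
    · intro k
      by_cases hk : k < j
      · apply card_le_card
        intro x hx
        rw [mem_inter, mem_Icc, mem_insert, mem_erase] at hx
        rw [mem_inter, mem_Icc]
        refine ⟨?_, hx.2⟩
        rcases hx.1 with rfl | h
        · exact hi.1
        · by_contra hxC
          have := hjmin x (mem_sdiff.2 ⟨h.2, hxC⟩)
          omega
      · refine le_trans ?_ (hdom k)
        have hjk : j ∈ B ∩ Icc 1 k := mem_inter.2 ⟨hj.1, mem_Icc.2 ⟨hj1.1, by omega⟩⟩
        have hsub : insert i (B.erase j) ∩ Icc 1 k ⊆ insert i ((B ∩ Icc 1 k).erase j) := by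
          intro x hx
          rw [mem_inter, mem_insert, mem_erase] at hx
          rw [mem_insert, mem_erase, mem_inter]
          tauto
        have h1 := card_le_card hsub
        have h2 := card_insert_le i ((B ∩ Icc 1 k).erase j)
        rw [card_erase_of_mem hjk] at h2
        have : 0 < (B ∩ Icc 1 k).card := card_pos.2 ⟨j, hjk⟩
        omega
    · apply insert_subset (hC hi.1)
      exact (erase_subset _ _).trans hBn

theorem cover_full (n b t : ℕ) (ht : 1 ≤ t) (hn : b + t ≤ n + 1) (htn : t ≤ n + 1)
    (G : Finset (Finset ℕ))
    (hG : G ⊆ (Icc 1 n).powersetCard b) (hGi : initialFam n G) (hcov : coverGE n t G)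
    (C : Finset ℕ) (hC : C ⊆ Icc 1 (b + t - 1)) (hCc : C.card = b) : C ∈ G := by
  have : ∃ B ∈ G, ¬ (Icc 1 (t-1) ∩ B).Nonempty := by
    by_contra h
    push Not at h
    have h2 := hcov (Icc 1 (t-1)) (Icc_subset_Icc le_rfl (by omega))
      (fun A hA => by simpa [Finset.nonempty_iff_ne_empty] using h A hA)
    simp at h2
    omega
  obtain ⟨B, hB, hBe⟩ := this
  rw [not_nonempty_iff_eq_empty] at hBe
  have hBn := mem_powersetCard.1 (hG hB)
  refine shift_down n G hGi C (hC.trans (Icc_subset_Icc le_rfl (by omega))) _ B hB rfl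
    (by omega) ?_ hBn.1
  intro k
  have h1 : B ∩ Icc 1 k ⊆ Icc t k := by
    intro x hx
    rw [mem_inter, mem_Icc] at hx
    rw [mem_Icc]
    refine ⟨?_, hx.2.2⟩
    by_contra hlt
    have : x ∈ Icc 1 (t-1) ∩ B := mem_inter.2 ⟨mem_Icc.2 ⟨hx.2.1, by omega⟩, hx.1⟩
    rw [hBe] at this
    simp at this
  have h1 := card_le_card h1
  have h1' := card_le_card (inter_subset_left : B ∩ Icc 1 k ⊆ B)
  have h2 : C ⊆ (C ∩ Icc 1 k) ∪ Icc (k+1) (b+t-1) := by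
    intro x hx
    have := mem_Icc.1 (hC hx)
    simp only [mem_union, mem_inter, mem_Icc]
    by_cases hk : x ≤ k
    · left; exact ⟨hx, by omega, hk⟩
    · right; omega
  have h2 := (card_le_card h2).trans (card_union_le _ _)
  simp at h1 h2
  omega

theorem inter_ge (n b t : ℕ) (ht : 1 ≤ t) (hn : b + t ≤ n + 1)
    (G : Finset (Finset ℕ))
    (hG : G ⊆ (Icc 1 n).powersetCard b) (hGi : initialFam n G) (hcov : coverGE n t G)
    (A : Finset ℕ) (hA : ∀ B ∈ G, (A ∩ B).Nonempty) :
    t ≤ (A ∩ Icc 1 (b + t - 1)).card := by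
  by_contra h
  have h1 : b ≤ (Icc 1 (b+t-1) \ A).card := by
    have := card_sdiff_add_card_inter (Icc 1 (b+t-1)) A
    rw [inter_comm] at this
    simp at this
    omega
  obtain ⟨C, hC, hCc⟩ := exists_subset_card_eq h1
  have hCG := cover_full n b t ht hn (by omega) G hG hGi hcov C (hC.trans sdiff_subset) hCc
  obtain ⟨x, hx⟩ := hA C hCG
  rw [mem_inter] at hx
  exact (mem_sdiff.1 (hC hx.2)).2 hx.1

theorem card_Hfam_le (n a m t : ℕ) (hm : m ≤ n) (hta : t ≤ a) :
    (Hfam n a m t).card + ∑ i ∈ range t, m.choose i * (n - m).choose (a - i) ≤ n.choose a := by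
  have h0 : (Hfam n a m t).card
      + (((Icc 1 n).powersetCard a).filter (fun A => ¬ t ≤ (A ∩ Icc 1 m).card)).card
      = n.choose a := by
    rw [Hfam, card_filter_add_card_filter_not]; simp
  have h1 : ∑ i ∈ range t, m.choose i * (n - m).choose (a - i) ≤
      (((Icc 1 n).powersetCard a).filter (fun A => ¬ t ≤ (A ∩ Icc 1 m).card)).card := by
    rw [card_eq_sum_card_fiberwise (f := fun A => (A ∩ Icc 1 m).card) (t := range t)]
    · apply sum_le_sum
      intro i hi
      rw [mem_range] at hi
      have hc : m.choose i * (n - m).choose (a - i) =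
          ((Icc 1 m).powersetCard i ×ˢ (Icc (m+1) n).powersetCard (a-i)).card := by
        simp [card_product]
      rw [hc]
      have hP : ∀ P Q : Finset ℕ, P ⊆ Icc 1 m → Q ⊆ Icc (m+1) n →
          (P ∪ Q) ∩ Icc 1 m = P ∧ (P ∪ Q) \ Icc 1 m = Q := by
        intro P Q hP hQ
        constructor
        · ext x
          simp only [mem_inter, mem_union]
          constructor
          · rintro ⟨h | h, h2⟩
            · exact h
            · have := mem_Icc.1 (hQ h); have := mem_Icc.1 h2; omega
          · intro h; exact ⟨Or.inl h, hP h⟩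
        · ext x
          simp only [mem_sdiff, mem_union]
          constructor
          · rintro ⟨h | h, h2⟩
            · exact absurd (hP h) h2
            · exact h
          · intro h
            refine ⟨Or.inr h, fun h2 => ?_⟩
            have := mem_Icc.1 (hQ h); have := mem_Icc.1 h2; omega
      apply card_le_card_of_injOn (fun p => p.1 ∪ p.2)
      · rintro ⟨P, Q⟩ hPQ
        rw [mem_coe, mem_product, mem_powersetCard, mem_powersetCard] at hPQ
        obtain ⟨⟨p1, p2⟩, q1, q2⟩ := hPQ
        simp only at p1 p2 q1 q2
        obtain ⟨e1, e2⟩ := hP P Q p1 q1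
        simp only [mem_coe, mem_filter, mem_powersetCard, e1]
        have hd : Disjoint P Q := by
          rw [← e2]
          exact disjoint_of_subset_left p1 disjoint_sdiff
        refine ⟨⟨⟨union_subset (p1.trans (Icc_subset_Icc le_rfl hm))
          (q1.trans (Icc_subset_Icc (by omega) le_rfl)), ?_⟩, by omega⟩, p2⟩
        rw [card_union_of_disjoint hd]; omega
      · rintro ⟨P, Q⟩ hPQ ⟨P', Q'⟩ hPQ' h
        rw [mem_coe, mem_product, mem_powersetCard, mem_powersetCard] at hPQ hPQ'
        have e := hP P Q hPQ.1.1 hPQ.2.1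
        have e' := hP P' Q' hPQ'.1.1 hPQ'.2.1
        have h' : P ∪ Q = P' ∪ Q' := h
        rw [h'] at e
        rw [Prod.mk.injEq]
        exact ⟨e.1.symm.trans e'.1, e.2.symm.trans e'.2⟩
    · intro A hA
      simp only [mem_coe, mem_filter] at hA
      simp only [coe_range, Set.mem_Iio]
      omega
  omega

theorem stmt9 (n a b s t : ℕ) (hb : 2 ≤ b) (hs : 2 ≤ s) (ht : 2 ≤ t)
    (habt : b + t ≤ a + 1) (hnab : a + b ≤ n)
    (F G : Finset (Finset ℕ))
    (hF : F ⊆ (Finset.Icc 1 n).powersetCard a)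
    (hG : G ⊆ (Finset.Icc 1 n).powersetCard b)
    (hFinit : initialFam n F)
    (hGinit : initialFam n G)
    (hcross : crossInt F G)
    (hFcov : coverGE n s F)
    (hGcov : coverGE n t G) :
    (F.card : ℤ) + G.card ≤ HtSize n a b t := by
  obtain ⟨m, hm⟩ : ∃ m, m = b + t - 1 := ⟨_, rfl⟩
  have hFH : F ⊆ Hfam n a m t := by
    intro A hA
    refine mem_Hfam.2 ⟨mem_powersetCard.1 (hF hA), ?_⟩
    rw [hm]
    exact inter_ge n b t (by omega) (by omega) G hG hGinit hGcov A (hcross A hA)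
  have hFcov2 : coverGE n 2 F := fun T h1 h2 => hs.trans (hFcov T h1 h2)
  have hG2 : ∀ B ∈ G, 2 ≤ (B ∩ Icc 1 (a + 1)).card := by
    intro B hB
    have := inter_ge n a 2 (by omega) (by omega) F hF hFinit hFcov2 B
      (fun A hA => by rw [inter_comm]; exact hcross A hA B hB)
    exact this
  have hmain := core (n + m) n a b m t F (G.filter (fun B => (B ∩ Icc 1 m).card + t ≤ m)) rfl
    (by omega) hnab hFH ((filter_subset _ _).trans hG) (fun B hB => (mem_filter.1 hB).2)
    (fun A hA B hB => hcross A hA B (mem_filter.1 hB).1) hFinit ?_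
  · have hrest : (G.filter (fun B => ¬ (B ∩ Icc 1 m).card + t ≤ m)).card ≤ m.choose b := by
      have : G.filter (fun B => ¬ (B ∩ Icc 1 m).card + t ≤ m) ⊆ (Icc 1 m).powersetCard b := by
        intro B hB
        rw [mem_filter] at hB
        have h := mem_powersetCard.1 (hG hB.1)
        have : B ∩ Icc 1 m = B := eq_of_subset_of_card_le inter_subset_left (by omega)
        exact mem_powersetCard.2 ⟨inter_eq_left.1 this, h.2⟩
      simpa using card_le_card this
    have hsplit := card_filter_add_card_filter_not (s := G)
      (fun B => (B ∩ Icc 1 m).card + t ≤ m)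
    have hH := card_Hfam_le n a m t (by omega) (by omega)
    have e : n - b - t + 1 = n - m := by omega
    unfold HtSize
    rw [e, ← hm]
    zify at hmain hrest hsplit hH
    linarith
  · by_cases h : t + b ≤ a
    · exact Or.inl h
    · right
      refine ⟨by omega, by omega, fun B hB => ?_⟩
      have : a = m := by omega
      rw [← this]
      exact hG2 B (mem_filter.1 hB).1
end
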